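/- Let E be a Riesz space with point separating order dual, write Z(E^~) = C(K) with K hyperstonian, and let m : Z(E^~)'' = C(K)'' → Z(E^{~~}) be the Arens homomorphism of the bidual of Z(E^~). Then there is an idempotent π ∈ C(K)'' such that Z(E^{~~}) = π·C(K)'' and Ker(m) = (1−π)·C(K)''. -/

import Mathlib

noncomputable section

open Set

/-- A map between preordered sets is *order bounded* if it maps order intervals into
order intervals. -/
def IsOrdBdd {E F : Type*} [Preorder E] [Preorder F] (f : E → F) : Prop :=
  ∀ a b : E, ∃ c d : F, ∀ x : E, a ≤ x → x ≤ b → c ≤ f x ∧ f x ≤ d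

/-- A map of a Riesz space is *band preserving* if it preserves disjointness. -/
def IsBandPres {E : Type*} [Lattice E] [AddCommGroup E] (T : E → E) : Prop :=
  ∀ x y : E, |x| ⊓ |y| = 0 → |T x| ⊓ |y| = 0

/-- An *orthomorphism*: an order bounded, band preserving linear map. -/
def IsOrtho {E : Type*} [Lattice E] [AddCommGroup E] [Module ℝ E] (T : E → E) : Prop :=
  IsLinearMap ℝ T ∧ IsOrdBdd T ∧ IsBandPres T

/-- A member of the *ideal center* `Z(E)`: an orthomorphism dominated by a multiple of the
identity. -/
def IsCentral {E : Type*} [Lattice E] [AddCommGroup E] [Module ℝ E] (T : E → E) : Prop :=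
  IsOrtho T ∧ ∃ c : ℝ, ∀ x : E, 0 ≤ x → -(c • x) ≤ T x ∧ T x ≤ c • x

/-- Order continuity of a real functional: it converges to `0` along every downward
directed system with infimum `0`. -/
def IsOrderContinuousFun {X : Type*} [Lattice X] [AddCommGroup X] (φ : X → ℝ) : Prop :=
  ∀ s : Set X, s.Nonempty → DirectedOn (· ≥ ·) s → IsGLB s 0 →
    ∀ ε : ℝ, 0 < ε → ∃ x ∈ s, ∀ y ∈ s, y ≤ x → |φ y| < ε

/-- `p` realizes the Riesz space `D` as the order dual `E^∼` of `E`. -/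
structure IsOrderDual (E D : Type*) [Lattice E] [AddCommGroup E] [Module ℝ E]
    [Lattice D] [AddCommGroup D] [Module ℝ D] (p : D → E → ℝ) : Prop where
  lin_fun : ∀ f : D, IsLinearMap ℝ (p f)
  lin_vec : ∀ x : E, IsLinearMap ℝ fun f => p f x
  bdd : ∀ f : D, IsOrdBdd (p f)
  inj : ∀ f g : D, (∀ x, p f x = p g x) → f = g
  surj : ∀ φ : E → ℝ, IsLinearMap ℝ φ → IsOrdBdd φ → ∃ f : D, ∀ x, p f x = φ x
  le_iff : ∀ f g : D, f ≤ g ↔ ∀ x : E, 0 ≤ x → p f x ≤ p g x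

/-- `p` realizes the Riesz space `B` as the order continuous order dual `(X^∼)ₙ` of `X`
(used for `X = A^∼`, giving `B = (A^∼)ₙ^∼`). -/
structure IsOrderContinuousDual (X B : Type*) [Lattice X] [AddCommGroup X] [Module ℝ X]
    [Lattice B] [AddCommGroup B] [Module ℝ B] (p : B → X → ℝ) : Prop where
  lin_fun : ∀ F : B, IsLinearMap ℝ (p F)
  lin_vec : ∀ f : X, IsLinearMap ℝ fun F => p F f
  bdd : ∀ F : B, IsOrdBdd (p F)
  cont : ∀ F : B, IsOrderContinuousFun (p F)
  inj : ∀ F G : B, (∀ f, p F f = p G f) → F = G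
  surj : ∀ φ : X → ℝ, IsLinearMap ℝ φ → IsOrdBdd φ → IsOrderContinuousFun φ →
    ∃ F : B, ∀ f, p F f = φ f
  le_iff : ∀ F G : B, F ≤ G ↔ ∀ f : X, 0 ≤ f → p F f ≤ p G f

/-- `ρ` realizes the lattice-ordered algebra `O` as the `f`-algebra `Orth(E)` of all
orthomorphisms of `E`. -/
structure IsOrthAlg (E O : Type*) [Lattice E] [AddCommGroup E] [Module ℝ E]
    [Lattice O] [Ring O] [Module ℝ O] (ρ : O → E → E) : Prop where
  ortho : ∀ a : O, IsOrtho (ρ a)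
  lin_vec : ∀ x : E, IsLinearMap ℝ fun a => ρ a x
  map_one : ∀ x : E, ρ 1 x = x
  map_mul : ∀ (a b : O) (x : E), ρ (a * b) x = ρ a (ρ b x)
  inj : ∀ a b : O, (∀ x, ρ a x = ρ b x) → a = b
  surj : ∀ T : E → E, IsOrtho T → ∃ a : O, ∀ x, ρ a x = T x
  le_iff : ∀ a b : O, a ≤ b ↔ ∀ x : E, 0 ≤ x → ρ a x ≤ ρ b x

/-- `ρ` realizes the normed lattice-ordered algebra `Z` as the ideal center `Z(E)` of `E`,
an AM-space whose norm is the order unit norm (the order/algebra unit being `id`). -/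
structure IsCenterOf (E Z : Type*) [Lattice E] [AddCommGroup E] [Module ℝ E]
    [Lattice Z] [NormedRing Z] [NormedAlgebra ℝ Z] (ρ : Z → E → E) : Prop where
  central : ∀ a : Z, IsCentral (ρ a)
  lin_vec : ∀ x : E, IsLinearMap ℝ fun a => ρ a x
  map_one : ∀ x : E, ρ 1 x = x
  map_mul : ∀ (a b : Z) (x : E), ρ (a * b) x = ρ a (ρ b x)
  inj : ∀ a b : Z, (∀ x, ρ a x = ρ b x) → a = b
  surj : ∀ T : E → E, IsCentral T → ∃ a : Z, ∀ x, ρ a x = T x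
  le_iff : ∀ a b : Z, a ≤ b ↔ ∀ x : E, 0 ≤ x → ρ a x ≤ ρ b x
  norm_le_iff : ∀ (a : Z) (c : ℝ), 0 ≤ c →
    (‖a‖ ≤ c ↔ ∀ x : E, 0 ≤ x → -(c • x) ≤ ρ a x ∧ ρ a x ≤ c • x)

/-- The pairing `p : D → E → ℝ` separates the points of `E`. -/
def SepPoints {E D : Type*} [Zero E] (p : D → E → ℝ) : Prop :=
  ∀ x : E, (∀ f : D, p f x = 0) → x = 0

/-- `y` belongs to the `σ(E,D)`-closure of `s ⊆ E`, for the pairing `p : D → E → ℝ`. -/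
def InWeakClosure {E D : Type*} (p : D → E → ℝ) (s : Set E) (y : E) : Prop :=
  ∀ (fs : Finset D) (ε : ℝ), 0 < ε → ∃ z ∈ s, ∀ f ∈ fs, |p f z - p f y| < ε

/-- `E` has a *topologically full center*: for each `x ∈ E₊` the `σ(E,E^∼)`-closure of
`Z(E)x` contains the order ideal generated by `x`.  Here `p : D → E → ℝ` is the duality
with `E^∼` and `ρ : Z → E → E` is the action of the ideal center. -/
def TopFullCenter {E D Z : Type*} [Lattice E] [AddCommGroup E] [Module ℝ E]
    (p : D → E → ℝ) (ρ : Z → E → E) : Prop :=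
  ∀ x : E, 0 ≤ x → ∀ y : E, (∃ c : ℝ, 0 ≤ c ∧ |y| ≤ c • x) →
    InWeakClosure p {z | ∃ T : Z, ρ T x = z} y

/-- `FG` is the Arens product `F ⬝ G` in the order bidual `B` of the algebra `A`:
`(F⬝G)(f) = F(G⬝f)`, `(G⬝f)(a) = G(f⬝a)`, `(f⬝a)(b) = f(ab)`; `pA : DA → A → ℝ` is the
duality of `A` with `A^∼` and `pB : B → DA → ℝ` that of `(A^∼)ₙ^∼` with `A^∼`. -/
def IsArensProduct {A DA B : Type*} [Mul A] (pA : DA → A → ℝ) (pB : B → DA → ℝ)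
    (F G FG : B) : Prop :=
  ∀ f Gf : DA,
    (∀ (a : A) (fa : DA), (∀ b : A, pA fa b = pA f (a * b)) → pA Gf a = pB G fa) →
    pB FG f = pB F Gf

/-- The ring structure of `B` is the Arens multiplication inherited from `A`, with unit the
canonical image of `1 ∈ A`. -/
structure IsArensAlgebra {A DA B : Type*} [Monoid A] [Ring B]
    (pA : DA → A → ℝ) (pB : B → DA → ℝ) : Prop where
  mul_def : ∀ F G : B, IsArensProduct pA pB F G (F * G)
  one_def : ∀ f : DA, pB 1 f = pA f 1

section NormedArens

variable (Z : Type*) [NormedRing Z] [NormedAlgebra ℝ Z]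

/-- First step of the Arens construction: `f ⬝ a` for `f ∈ Z'`, `a ∈ Z`:
`(f⬝a)(b) = f(ab)`. -/
def arensDot (f : Z →L[ℝ] ℝ) (a : Z) : Z →L[ℝ] ℝ :=
  f.comp (ContinuousLinearMap.mul ℝ Z a)

/-- `a ↦ f ⬝ a` as a continuous linear map. -/
def arensDotL (f : Z →L[ℝ] ℝ) : Z →L[ℝ] Z →L[ℝ] ℝ :=
  (ContinuousLinearMap.compL ℝ Z Z ℝ f).comp (ContinuousLinearMap.mul ℝ Z)

/-- Second step of the Arens construction: `F ⬝ f` for `F ∈ Z''`, `f ∈ Z'`: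
`(F⬝f)(a) = F(f⬝a)`. -/
def arensFDot (F : (Z →L[ℝ] ℝ) →L[ℝ] ℝ) (f : Z →L[ℝ] ℝ) : Z →L[ℝ] ℝ :=
  F.comp (arensDotL Z f)

/-- `f ↦ f ⬝ ·` as a continuous linear map. -/
def arensDotLL : (Z →L[ℝ] ℝ) →L[ℝ] Z →L[ℝ] Z →L[ℝ] ℝ :=
  ((ContinuousLinearMap.compL ℝ Z (Z →L[ℝ] Z) (Z →L[ℝ] ℝ)).flip
      (ContinuousLinearMap.mul ℝ Z)).comp (ContinuousLinearMap.compL ℝ Z Z ℝ)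

/-- `f ↦ F ⬝ f` as a continuous linear map. -/
def arensFDotL (F : (Z →L[ℝ] ℝ) →L[ℝ] ℝ) : (Z →L[ℝ] ℝ) →L[ℝ] Z →L[ℝ] ℝ :=
  (ContinuousLinearMap.compL ℝ Z (Z →L[ℝ] ℝ) ℝ F).comp (arensDotLL Z)

/-- The *Arens product* on the norm bidual `Z''`: `(F⬝G)(f) = F(G⬝f)`. -/
def arensMul (F G : (Z →L[ℝ] ℝ) →L[ℝ] ℝ) : (Z →L[ℝ] ℝ) →L[ℝ] ℝ :=
  F.comp (arensFDotL Z G)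

/-- The canonical image of `1 ∈ Z` in the bidual `Z''`; it is the unit for the Arens
product. -/
def arensOne : (Z →L[ℝ] ℝ) →L[ℝ] ℝ := ContinuousLinearMap.apply ℝ ℝ (1 : Z)

end NormedArens

section DualOrder

variable {Z : Type*} [Lattice Z] [NormedRing Z] [NormedAlgebra ℝ Z]

/-- Positivity of a functional in `Z'`. -/
def dualNonneg (μ : Z →L[ℝ] ℝ) : Prop := ∀ a : Z, 0 ≤ a → 0 ≤ μ a

/-- The canonical order of the bidual `Z''`. -/
def bidualLe (F G : (Z →L[ℝ] ℝ) →L[ℝ] ℝ) : Prop :=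
  ∀ μ : Z →L[ℝ] ℝ, dualNonneg μ → F μ ≤ G μ

/-- `H = F ⊔ G` in the bidual `Z''`. -/
def IsBidualSup (F G H : (Z →L[ℝ] ℝ) →L[ℝ] ℝ) : Prop :=
  bidualLe F H ∧ bidualLe G H ∧
    ∀ K : (Z →L[ℝ] ℝ) →L[ℝ] ℝ, bidualLe F K → bidualLe G K → bidualLe H K

/-- `s ⊆ Z''` is downward directed with infimum `0`. -/
def BidualDownTo0 (s : Set ((Z →L[ℝ] ℝ) →L[ℝ] ℝ)) : Prop :=
  s.Nonempty ∧ (∀ F ∈ s, ∀ G ∈ s, ∃ H ∈ s, bidualLe H F ∧ bidualLe H G) ∧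
    (∀ F ∈ s, bidualLe 0 F) ∧ ∀ K, (∀ F ∈ s, bidualLe K F) → bidualLe K 0

/-- The Riesz–Kantorovich formula for `|μ|(a)`, `μ ∈ Z'`, `a ∈ Z₊`. -/
def dualAbs (μ : Z →L[ℝ] ℝ) (a : Z) : ℝ := sSup ((fun b => μ b) '' {b : Z | |b| ≤ a})

/-- Disjointness `|μ| ⊓ |ν| = 0` in `Z'`. -/
def DualDisjoint (μ ν : Z →L[ℝ] ℝ) : Prop :=
  ∀ a : Z, 0 ≤ a → ∀ ε : ℝ, 0 < ε →
    ∃ b c : Z, 0 ≤ b ∧ 0 ≤ c ∧ b + c = a ∧ dualAbs μ b + dualAbs ν c < ε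

/-- The Riesz–Kantorovich formula for `|F|(μ)`, `F ∈ Z''`, `μ ∈ Z'₊`. -/
def bidualAbs (F : (Z →L[ℝ] ℝ) →L[ℝ] ℝ) (μ : Z →L[ℝ] ℝ) : ℝ :=
  sSup ((fun ν => F ν) '' {ν : Z →L[ℝ] ℝ | ∀ a : Z, 0 ≤ a → dualAbs ν a ≤ μ a})

/-- Disjointness `|F| ⊓ |G| = 0` in `Z''`. -/
def BidualDisjoint (F G : (Z →L[ℝ] ℝ) →L[ℝ] ℝ) : Prop :=
  ∀ μ : Z →L[ℝ] ℝ, dualNonneg μ → ∀ ε : ℝ, 0 < ε →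
    ∃ μ₁ μ₂ : Z →L[ℝ] ℝ, dualNonneg μ₁ ∧ dualNonneg μ₂ ∧ μ₁ + μ₂ = μ ∧
      bidualAbs F μ₁ + bidualAbs G μ₂ < ε

end DualOrder

/-- A member of the ideal center `Z(J)` of an order ideal `J` of a Riesz space, encoded as a
map defined on the ambient space whose restriction to `J` is the actual operator. -/
def IsCentralOn {D : Type*} [Lattice D] [AddCommGroup D] [Module ℝ D]
    (J : Set D) (S : D → D) : Prop :=
  (∀ f ∈ J, S f ∈ J) ∧ (∀ f ∈ J, ∀ g ∈ J, S (f + g) = S f + S g) ∧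
    (∀ (c : ℝ), ∀ f ∈ J, S (c • f) = c • S f) ∧
    ∃ c : ℝ, ∀ f ∈ J, 0 ≤ f → -(c • f) ≤ S f ∧ S f ≤ c • f

end

open Set

section RieszKantorovich

theorem smul_image_Icc_zero {V : Type*} [Lattice V] [AddCommGroup V] [Module ℝ V]
    [PosSMulMono ℝ V] {c : ℝ} (hc : 0 < c) (a : V) :
    (fun x => c • x) '' Icc 0 a = Icc 0 (c • a) := by
  ext x
  constructor
  · rintro ⟨y, ⟨h0, h1⟩, rfl⟩
    exact ⟨smul_nonneg hc.le h0, smul_le_smul_of_nonneg_left h1 hc.le⟩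
  · rintro ⟨h0, h1⟩
    refine ⟨c⁻¹ • x, ⟨smul_nonneg (inv_nonneg.2 hc.le) h0, ?_⟩, smul_inv_smul₀ hc.ne' x⟩
    simpa [smul_smul, hc.ne'] using smul_le_smul_of_nonneg_left h1 (inv_nonneg.2 hc.le)

open Pointwise in
/-- The Riesz decomposition property. -/
theorem Icc_zero_add_Icc_zero {V : Type*} [Lattice V] [AddCommGroup V] [IsOrderedAddMonoid V]
    {a b : V} (ha : 0 ≤ a) (hb : 0 ≤ b) :
    Icc 0 a + Icc 0 b = Icc 0 (a + b) := by
  ext x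
  constructor
  · rintro ⟨y, ⟨h0, h1⟩, z, ⟨h2, h3⟩, rfl⟩
    exact ⟨add_nonneg h0 h2, add_le_add h1 h3⟩
  · rintro ⟨h0, h1⟩
    refine ⟨x ⊓ a, ⟨le_inf h0 ha, inf_le_right⟩, x - x ⊓ a, ⟨sub_nonneg.2 inf_le_left, ?_⟩,
      add_sub_cancel _ _⟩
    rw [sub_le_iff_le_add, ← sub_le_iff_le_add']
    exact le_inf (sub_le_self _ hb) (by rwa [sub_le_iff_le_add])

variable {V : Type*} [Lattice V] [AddCommGroup V] [IsOrderedAddMonoid V] [Module ℝ V]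

/-- A positively homogeneous additive function on the positive cone of a Riesz space extends to a
linear functional. -/
theorem exists_linearMap_eq_on_cone (θ : V → ℝ)
    (hadd : ∀ a b : V, 0 ≤ a → 0 ≤ b → θ (a + b) = θ a + θ b)
    (hsmul : ∀ (c : ℝ) (a : V), 0 < c → 0 ≤ a → θ (c • a) = c * θ a) [PosSMulMono ℝ V] :
    ∃ ψ : V →ₗ[ℝ] ℝ, ∀ a : V, 0 ≤ a → ψ a = θ a := by
  have h0 : θ 0 = 0 := by simpa using hadd 0 0 le_rfl le_rfl
  have key : ∀ a b : V, 0 ≤ a → 0 ≤ b → θ (a - b)⁺ - θ (a - b)⁻ = θ a - θ b := by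
    intro a b ha hb
    have h1 : (a - b)⁺ + b = a + (a - b)⁻ := by
      have := posPart_sub_negPart (a - b)
      rw [sub_eq_sub_iff_add_eq_add] at this
      rw [this]
    have h2 := congrArg θ h1
    rw [hadd _ _ (posPart_nonneg _) hb, hadd _ _ ha (negPart_nonneg _)] at h2
    linarith
  refine ⟨{ toFun := fun v => θ v⁺ - θ v⁻, map_add' := ?_, map_smul' := ?_ }, ?_⟩
  · intro v w
    have h1 : v + w = (v⁺ + w⁺) - (v⁻ + w⁻) := by
      conv_lhs => rw [← posPart_sub_negPart v, ← posPart_sub_negPart w]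
      abel
    rw [h1, key _ _ (add_nonneg (posPart_nonneg _) (posPart_nonneg _))
      (add_nonneg (negPart_nonneg _) (negPart_nonneg _)),
      hadd _ _ (posPart_nonneg _) (posPart_nonneg _),
      hadd _ _ (negPart_nonneg _) (negPart_nonneg _)]
    ring
  · intro c v
    rw [RingHom.id_apply, smul_eq_mul]
    rcases lt_trichotomy c 0 with hc | rfl | hc
    · have h1 : c • v = (-c) • v⁻ - (-c) • v⁺ := by
        rw [← smul_sub, neg_smul, ← smul_neg, neg_sub, posPart_sub_negPart]
      have hc' : 0 < -c := by linarith
      rw [h1, key _ _ (smul_nonneg hc'.le (negPart_nonneg _))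
        (smul_nonneg hc'.le (posPart_nonneg _)), hsmul _ _ hc' (negPart_nonneg _),
        hsmul _ _ hc' (posPart_nonneg _)]
      ring
    · simp
    · have h1 : c • v = c • v⁺ - c • v⁻ := by
        rw [← smul_sub, posPart_sub_negPart]
      rw [h1, key _ _ (smul_nonneg hc.le (posPart_nonneg _))
        (smul_nonneg hc.le (negPart_nonneg _)), hsmul _ _ hc (posPart_nonneg _),
        hsmul _ _ hc (negPart_nonneg _)]
      ring
  · intro a ha
    have := key a 0 ha le_rfl
    simpa [h0] using this

variable [PosSMulMono ℝ V]

/-- The Riesz–Kantorovich formula for the positive part of an order bounded functional. -/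
theorem exists_isLUB_image_Icc (φ : V →ₗ[ℝ] ℝ) (hφ : ∀ a : V, BddAbove (φ '' Icc 0 a)) :
    ∃ ψ : V →ₗ[ℝ] ℝ, ∀ a : V, 0 ≤ a → IsLUB (φ '' Icc 0 a) (ψ a) := by
  have hne : ∀ a : V, 0 ≤ a → (φ '' Icc 0 a).Nonempty := fun a ha => ⟨_, 0, ⟨le_rfl, ha⟩, rfl⟩
  obtain ⟨ψ, hψ⟩ := exists_linearMap_eq_on_cone (fun a => sSup (φ '' Icc 0 a)) (by
      intro a b ha hb
      rw [← Icc_zero_add_Icc_zero ha hb, image_add, csSup_add (hne a ha) (hφ a) (hne b hb) (hφ b)])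
    (by
      intro c a hc ha
      rw [← smul_image_Icc_zero hc, image_image, ← smul_eq_mul, ← Real.sSup_smul_of_nonneg hc.le,
        ← image_smul, image_image]
      simp only [map_smul])
  exact ⟨ψ, fun a ha => by rw [hψ a ha]; exact isLUB_csSup (hne a ha) (hφ a)⟩

/-- A bounded upward directed family of functionals has a supremum, computed pointwise on the
positive cone. -/
theorem exists_isLUB_image_apply {s : Set (V →ₗ[ℝ] ℝ)} (hs : s.Nonempty)
    (hdir : ∀ φ ∈ s, ∀ ψ ∈ s, ∃ χ ∈ s, ∀ a : V, 0 ≤ a → φ a ≤ χ a ∧ ψ a ≤ χ a)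
    (hbdd : ∀ a : V, 0 ≤ a → BddAbove ((fun φ : V →ₗ[ℝ] ℝ => φ a) '' s)) :
    ∃ ψ : V →ₗ[ℝ] ℝ, ∀ a : V, 0 ≤ a → IsLUB ((fun φ : V →ₗ[ℝ] ℝ => φ a) '' s) (ψ a) := by
  obtain ⟨ψ, hψ⟩ := exists_linearMap_eq_on_cone
    (fun a => sSup ((fun φ : V →ₗ[ℝ] ℝ => φ a) '' s)) (by
      intro a b ha hb
      apply le_antisymm
      · apply csSup_le (hs.image _)
        rintro _ ⟨φ, hφ, rfl⟩
        dsimp only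
        rw [map_add]
        exact add_le_add (le_csSup (hbdd a ha) ⟨φ, hφ, rfl⟩) (le_csSup (hbdd b hb) ⟨φ, hφ, rfl⟩)
      · rw [← le_sub_iff_add_le]
        apply csSup_le (hs.image _)
        rintro _ ⟨φ, hφ, rfl⟩
        rw [le_sub_comm]
        apply csSup_le (hs.image _)
        rintro _ ⟨χ, hχ, rfl⟩
        obtain ⟨ω, hω, h⟩ := hdir φ hφ χ hχ
        have h1 := le_csSup (hbdd (a + b) (add_nonneg ha hb)) ⟨ω, hω, rfl⟩
        have h2 := (h a ha).1
        have h3 := (h b hb).2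
        simp only [map_add] at h1 ⊢
        linarith)
    (by
      intro c a hc ha
      rw [← smul_eq_mul, ← Real.sSup_smul_of_nonneg hc.le, ← image_smul, image_image]
      simp only [map_smul])
  exact ⟨ψ, fun a ha => by rw [hψ a ha]; exact isLUB_csSup (hs.image _) (hbdd a ha)⟩

end RieszKantorovich

section HahnBanachKantorovich

open Submodule

variable {X V : Type*} [AddCommGroup X] [Module ℝ X] [Lattice V] [AddCommGroup V]
  [IsOrderedAddMonoid V] [Module ℝ V] [PosSMulMono ℝ V]

theorem LinearPMap.exists_lt_le_sublinear
    (hV : ∀ s : Set V, s.Nonempty → BddAbove s → ∃ d, IsLUB s d) (p : X → V)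
    (hsmul : ∀ (c : ℝ) (x : X), 0 < c → p (c • x) = c • p x)
    (hadd : ∀ x y : X, p (x + y) ≤ p x + p y)
    (f : X →ₗ.[ℝ] V) (hf : ∀ x : f.domain, f x ≤ p x) (hdom : f.domain ≠ ⊤) :
    ∃ g, f < g ∧ ∀ x : g.domain, g x ≤ p x := by
  obtain ⟨y, -, hy⟩ : ∃ y ∈ ⊤, y ∉ f.domain := SetLike.exists_of_lt (lt_top_iff_ne_top.2 hdom)
  have hle : ∀ x x' : f.domain, f x - p (x - y) ≤ p (x' + y) - f x' := by
    intro x x'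
    rw [sub_le_iff_le_add, sub_add_eq_add_sub, le_sub_iff_add_le, ← f.map_add]
    refine (hf _).trans ?_
    convert hadd (x' + y) (x - y) using 2
    push_cast
    abel
  obtain ⟨c, hc⟩ := hV (range fun x : f.domain => f x - p (x - y)) (range_nonempty _)
    ⟨_, by rintro _ ⟨x, rfl⟩; exact hle x 0⟩
  have le_c : ∀ x : f.domain, f x - p (x - y) ≤ c := fun x => hc.1 ⟨x, rfl⟩
  have c_le : ∀ x : f.domain, c ≤ p (x + y) - f x := fun x =>
    hc.2 (by rintro _ ⟨x', rfl⟩; exact hle x' x)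
  refine ⟨f.supSpanSingleton y c hy, ?_, ?_⟩
  · refine lt_iff_le_not_ge.2 ⟨f.left_le_sup _ _, fun H => ?_⟩
    replace H := LinearPMap.domain_mono.monotone H
    rw [LinearPMap.domain_supSpanSingleton, sup_le_iff, span_le, singleton_subset_iff] at H
    exact hy H.2
  · rintro ⟨z, hz⟩
    rcases mem_sup.1 hz with ⟨x, hx, y', hy', rfl⟩
    rcases mem_span_singleton.1 hy' with ⟨r, rfl⟩
    rw [LinearPMap.supSpanSingleton_apply_mk _ _ _ _ _ hx]
    rcases lt_trichotomy r 0 with hr | rfl | hr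
    · have hr' : 0 < -r := by linarith
      have h := smul_le_smul_of_nonneg_left (le_c ((-r)⁻¹ • ⟨x, hx⟩)) hr'.le
      rw [smul_sub, ← hsmul _ _ hr', f.map_smul, smul_inv_smul₀ hr'.ne', smul_sub,
        Submodule.coe_smul, smul_inv_smul₀ hr'.ne', sub_le_iff_le_add] at h
      rw [neg_smul, neg_smul, sub_neg_eq_add, neg_add_eq_sub, le_sub_iff_add_le] at h
      exact h
    · simpa using hf ⟨x, hx⟩
    · have h := smul_le_smul_of_nonneg_left (c_le (r⁻¹ • ⟨x, hx⟩)) hr.le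
      rw [smul_sub, ← hsmul _ _ hr, f.map_smul, smul_inv_smul₀ hr.ne', smul_add,
        Submodule.coe_smul, smul_inv_smul₀ hr.ne', le_sub_iff_add_le, add_comm] at h
      exact h

/-- The Hahn–Banach–Kantorovich theorem: linear operators into a Dedekind complete Riesz space
which are dominated by a sublinear operator extend with the same domination. -/
theorem exists_extension_of_le_sublinear_of_isLUB
    (hV : ∀ s : Set V, s.Nonempty → BddAbove s → ∃ d, IsLUB s d) (p : X → V)
    (hsmul : ∀ (c : ℝ) (x : X), 0 < c → p (c • x) = c • p x)
    (hadd : ∀ x y : X, p (x + y) ≤ p x + p y)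
    (f : X →ₗ.[ℝ] V) (hf : ∀ x : f.domain, f x ≤ p x) :
    ∃ g : X →ₗ[ℝ] V, (∀ x : f.domain, g x = f x) ∧ ∀ x, g x ≤ p x := by
  set S := {q : X →ₗ.[ℝ] V | ∀ x : q.domain, q x ≤ p x}
  have hSc : ∀ c, c ⊆ S → IsChain (· ≤ ·) c → ∀ y ∈ c, ∃ ub ∈ S, ∀ z ∈ c, z ≤ ub := by
    intro c hcs c_chain y hy
    have hcd : DirectedOn (· ≤ ·) c := c_chain.directedOn
    refine ⟨LinearPMap.sSup c hcd, ?_, fun _ ↦ LinearPMap.le_sSup hcd⟩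
    rintro ⟨x, hx⟩
    have hdir : DirectedOn (· ≤ ·) (LinearPMap.domain '' c) :=
      directedOn_image.2 (hcd.mono LinearPMap.domain_mono.monotone)
    rcases (mem_sSup_of_directed (Set.Nonempty.image _ ⟨y, hy⟩) hdir).1 hx with
      ⟨_, ⟨q, hqc, rfl⟩, hqx⟩
    have : q ≤ LinearPMap.sSup c hcd := LinearPMap.le_sSup _ hqc
    have h2 : q ⟨x, hqx⟩ = LinearPMap.sSup c hcd ⟨x, hx⟩ := this.2 rfl
    rw [← h2]
    exact hcs hqc ⟨x, hqx⟩
  obtain ⟨q, hfq, hqs, hq⟩ := zorn_le_nonempty₀ S hSc f hf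
  have htop : q.domain = ⊤ := by
    by_contra h
    obtain ⟨r, hqr, hr⟩ := q.exists_lt_le_sublinear hV p hsmul hadd hqs h
    exact hqr.not_ge (hq hr hqr.le)
  obtain ⟨dom, g⟩ := q
  obtain rfl : dom = ⊤ := htop
  exact ⟨g.comp (LinearMap.id.codRestrict ⊤ fun _ ↦ trivial), fun x => (hfq.2 rfl).symm,
    fun x => hqs ⟨x, trivial⟩⟩

end HahnBanachKantorovich

section BoundedFunctionals

variable {V : Type*} [NormedAddCommGroup V] [NormedSpace ℝ V]

theorem exists_abs_apply_le (F : V →L[ℝ] ℝ) : ∃ B : ℝ, 0 ≤ B ∧ ∀ v, |F v| ≤ B * ‖v‖ :=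
  ⟨‖F‖, norm_nonneg F, F.le_opNorm⟩

/-- The Hahn–Banach theorem, for a functional given by its graph. -/
theorem exists_clm_of_submodule_prod {G : Submodule ℝ (V × ℝ)} {c : ℝ} (hc : 0 ≤ c)
    (hG : ∀ q ∈ G, |q.2| ≤ c * ‖q.1‖) : ∃ F : V →L[ℝ] ℝ, ∀ q ∈ G, F q.1 = q.2 := by
  have hG0 : ∀ q ∈ G, q.1 = 0 → q.2 = 0 := fun q hq h0 => by
    have := hG q hq
    rw [h0, norm_zero, mul_zero] at this
    exact abs_nonpos_iff.1 this
  obtain ⟨F, hF, hFle⟩ := exists_extension_of_le_sublinear G.toLinearPMap (fun v => c * ‖v‖)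
    (fun t ht v => by
      rw [norm_smul, Real.norm_of_nonneg ht.le]
      ring)
    (fun v w => by
      rw [← mul_add]
      exact mul_le_mul_of_nonneg_left (norm_add_le v w) hc)
    (fun v => (le_abs_self _).trans (hG _ (Submodule.mem_graph_toLinearPMap hG0 v)))
  refine ⟨F.mkContinuous c fun v => abs_le'.2 ⟨hFle v, by simpa using hFle (-v)⟩, fun q hq => ?_⟩
  have h1 := hF ⟨q.1, _, hq, rfl⟩
  have h2 := G.sub_mem (Submodule.mem_graph_toLinearPMap hG0 ⟨q.1, _, hq, rfl⟩) hq
  exact h1.trans (sub_eq_zero.1 (hG0 _ h2 (sub_self _)))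

/-- Weak* compactness of bounded sets of functionals. -/
theorem WeakDual.nonempty_iInter_of_directed {ι : Type*} [Nonempty ι] (A : ι → Set (WeakDual ℝ V))
    (hdir : Directed (· ⊇ ·) A) (hne : ∀ i, (A i).Nonempty) (hclosed : ∀ i, IsClosed (A i))
    (B : ℝ) (hB0 : 0 ≤ B) (hB : ∀ i, ∀ F ∈ A i, ∀ v, |F v| ≤ B * ‖v‖) : (⋂ i, A i).Nonempty :=
  IsCompact.nonempty_iInter_of_directed_nonempty_isCompact_isClosed A hdir hne
    (fun i => (WeakDual.isCompact_closedBall (0 : StrongDual ℝ V) B).of_isClosed_subset (hclosed i)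
      fun F hF => by
        simpa using (WeakDual.toStrongDual F).opNorm_le_bound hB0 (hB i F hF))
    hclosed

end BoundedFunctionals

section ArensProduct

variable {K : Type*} [TopologicalSpace K] [CompactSpace K]

local notation "C_K" => C(K, ℝ)
local notation "dual_K" => C(K, ℝ) →L[ℝ] ℝ
local notation "bidual_K" => (C(K, ℝ) →L[ℝ] ℝ) →L[ℝ] ℝ

theorem arensMul_apply (F G : bidual_K) (μ : dual_K) :
    arensMul C_K F G μ = F (arensFDot C_K G μ) := rfl

theorem arensFDot_apply (F : bidual_K) (μ : dual_K) (a : C_K) :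
    arensFDot C_K F μ a = F (arensDot C_K μ a) := rfl

theorem arensDot_apply (μ : dual_K) (a b : C_K) : arensDot C_K μ a b = μ (a * b) := rfl

theorem arensOne_apply (μ : dual_K) : arensOne C_K μ = μ 1 := rfl

theorem ContinuousMap.abs_le_norm_smul_one (a : C_K) : |a| ≤ ‖a‖ • (1 : C_K) := by
  intro x
  simpa using a.norm_coe_le_norm x

theorem exists_abs_bidual_le (F : bidual_K) : ∃ B : ℝ, 0 ≤ B ∧ ∀ μ, |F μ| ≤ B * ‖μ‖ :=
  exists_abs_apply_le (V := StrongDual ℝ C_K) F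

theorem dualNonneg.mono {μ : dual_K} (hμ : dualNonneg μ) {a b : C_K} (h : a ≤ b) : μ a ≤ μ b := by
  have := hμ (b - a) (sub_nonneg.2 h)
  rw [map_sub] at this
  linarith

theorem dualNonneg.abs_apply_le {μ : dual_K} (hμ : dualNonneg μ) (a : C_K) : |μ a| ≤ μ |a| := by
  rw [abs_le]
  have h1 := hμ.mono (neg_le_abs a)
  rw [map_neg] at h1
  exact ⟨by linarith, hμ.mono (le_abs_self a)⟩

theorem dualNonneg.norm_le {μ : dual_K} (hμ : dualNonneg μ) : ‖μ‖ ≤ μ 1 := by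
  refine μ.opNorm_le_bound (hμ 1 zero_le_one) fun a => ?_
  have := hμ.mono a.abs_le_norm_smul_one
  rw [map_smul, smul_eq_mul] at this
  rw [Real.norm_eq_abs, mul_comm]
  exact (hμ.abs_apply_le a).trans this

/-- Jordan decomposition of functionals on `C(K)`. -/
theorem exists_dualNonneg_sub (μ : dual_K) :
    ∃ μ₁ μ₂ : dual_K, dualNonneg μ₁ ∧ dualNonneg μ₂ ∧ μ = μ₁ - μ₂ ∧ μ₁ 1 + μ₂ 1 ≤ 3 * ‖μ‖ := by
  have hle : ∀ a b : C_K, b ∈ Icc 0 a → μ b ≤ ‖μ‖ * ‖a‖ := by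
    rintro a b ⟨h0, h1⟩
    refine (le_abs_self _).trans ((μ.le_opNorm b).trans ?_)
    gcongr
    rw [ContinuousMap.norm_le _ (norm_nonneg _)]
    intro x
    rw [Real.norm_eq_abs, abs_of_nonneg (show 0 ≤ b x from h0 x)]
    exact (h1 x).trans ((le_abs_self _).trans (a.norm_coe_le_norm x))
  obtain ⟨ψ, hψ⟩ := exists_isLUB_image_Icc (μ : C_K →ₗ[ℝ] ℝ)
    (fun a => ⟨‖μ‖ * ‖a‖, by rintro _ ⟨b, hb, rfl⟩; exact hle a b hb⟩)
  have h0 : ∀ a, 0 ≤ a → 0 ≤ ψ a := fun a ha => (hψ a ha).1 ⟨0, ⟨le_rfl, ha⟩, map_zero μ⟩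
  have h1 : ∀ a, 0 ≤ a → μ a ≤ ψ a := fun a ha => (hψ a ha).1 ⟨a, ⟨ha, le_rfl⟩, rfl⟩
  have hmono : ∀ a b, a ≤ b → ψ a ≤ ψ b := fun a b h => by
    have := h0 (b - a) (sub_nonneg.2 h)
    rw [map_sub] at this
    linarith
  let ν : dual_K := ψ.mkContinuous (ψ 1) fun a => by
    have h2 := hmono _ _ ((le_abs_self a).trans a.abs_le_norm_smul_one)
    have h3 := hmono _ _ ((neg_le_abs a).trans a.abs_le_norm_smul_one)
    rw [map_neg] at h3
    rw [map_smul, smul_eq_mul] at h2 h3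
    rw [Real.norm_eq_abs, abs_le]
    constructor <;> linarith
  have hν : ∀ a, ν a = ψ a := fun _ => rfl
  refine ⟨ν, ν - μ, h0, fun a ha => sub_nonneg.2 (h1 a ha), by abel, ?_⟩
  have hone : ‖(1 : C_K)‖ ≤ 1 := by
    rw [ContinuousMap.norm_le _ zero_le_one]
    simp
  have h4 : ν 1 ≤ ‖μ‖ := by
    refine (hψ 1 zero_le_one).2 ?_
    rintro _ ⟨b, hb, rfl⟩
    exact (hle 1 b hb).trans (mul_le_of_le_one_right (norm_nonneg μ) hone)
  have h5 : -μ 1 ≤ ‖μ‖ := (neg_le_abs _).trans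
    ((μ.le_opNorm 1).trans (mul_le_of_le_one_right (norm_nonneg μ) hone))
  rw [sub_apply]
  linarith

theorem dualNonneg.arensDot {μ : dual_K} (hμ : dualNonneg μ) {a : C_K} (ha : 0 ≤ a) :
    dualNonneg (arensDot C_K μ a) := fun _ hb => hμ _ (mul_nonneg ha hb)

theorem dualNonneg.arensFDot {μ : dual_K} (hμ : dualNonneg μ) {F : bidual_K} (hF : bidualLe 0 F) :
    dualNonneg (arensFDot C_K F μ) := fun _ ha => hF _ (hμ.arensDot ha)

theorem dualNonneg.norm_arensDot_le {μ : dual_K} (hμ : dualNonneg μ) (a : C_K) :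
    ‖_root_.arensDot C_K μ a‖ ≤ μ |a| := by
  refine ContinuousLinearMap.opNorm_le_bound _ (hμ _ (abs_nonneg a)) fun b => ?_
  rw [arensDot_apply, Real.norm_eq_abs, mul_comm (μ |a|), ← smul_eq_mul ‖b‖, ← map_smul]
  refine (hμ.abs_apply_le _).trans (hμ.mono fun x => ?_)
  have := b.norm_coe_le_norm x
  rw [Real.norm_eq_abs] at this
  simpa [abs_mul, mul_comm] using mul_le_mul_of_nonneg_left this (abs_nonneg (a x))

theorem dualNonneg.abs_arensFDot_le {μ : dual_K} (hμ : dualNonneg μ) {F : bidual_K} {B : ℝ}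
    (hB0 : 0 ≤ B) (hB : ∀ ν, |F ν| ≤ B * ‖ν‖) (a : C_K) :
    |_root_.arensFDot C_K F μ a| ≤ B * μ |a| :=
  (hB _).trans (mul_le_mul_of_nonneg_left (hμ.norm_arensDot_le a) hB0)

theorem dualNonneg.norm_mul_apply_abs_le {μ : dual_K} (hμ : dualNonneg μ) (c : ℝ) (a : C_K) :
    2 * c * μ |a| ≤ μ (a * a) + c ^ 2 * μ 1 := by
  have h : (0 : C_K) ≤ a * a + c ^ 2 • (1 : C_K) - (2 * c) • |a| := fun x => by
    have := sq_nonneg (|a x| - c)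
    rw [sub_sq, sq_abs] at this
    simp
    nlinarith
  have := hμ _ h
  rw [map_sub, map_add, map_smul, map_smul, smul_eq_mul, smul_eq_mul] at this
  linarith

/-- `F ⬝ μ` is approximated, in the `L²(μ)`-sense, by functionals `μ ⬝ h` with `h ∈ C(K)`. -/
theorem dualNonneg.exists_approx {μ : dual_K} (hμ : dualNonneg μ) {F : bidual_K} {B R ε : ℝ}
    (hB0 : 0 ≤ B) (hB : ∀ ν, |F ν| ≤ B * ‖ν‖) (hR : 0 ≤ R) (hε : 0 < ε) :
    ∃ h : C_K, μ (h * h) ≤ 4 * (B ^ 2 * μ 1 + 1) ∧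
      ∀ a : C_K, μ (a * a) ≤ R → |_root_.arensFDot C_K F μ a - μ (h * a)| ≤ ε := by
  set ν := _root_.arensFDot C_K F μ
  set Q : C_K → ℝ := fun h => μ (h * h) / 2 - ν h with hQ
  have hbdd : BddBelow (range Q) := by
    refine ⟨-(B ^ 2 * μ 1), ?_⟩
    rintro _ ⟨h, rfl⟩
    have h1 := (le_abs_self _).trans (hμ.abs_arensFDot_le hB0 hB h)
    have h2 := hμ.norm_mul_apply_abs_le B h
    have h3 : 0 ≤ B ^ 2 * μ 1 := mul_nonneg (sq_nonneg _) (hμ _ zero_le_one)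
    simp only [hQ]
    linarith
  set τ := ε / (R + 1)
  have hτ : 0 < τ := by positivity
  have hτR : τ * R ≤ ε := by
    rw [div_mul_eq_mul_div, div_le_iff₀ (by positivity)]
    nlinarith
  set δ := min 1 (τ * ε / 2)
  have hδ : 0 < δ := lt_min one_pos (by positivity)
  obtain ⟨_, ⟨h, rfl⟩, hh⟩ := exists_lt_of_csInf_lt (range_nonempty Q)
    (show sInf (range Q) < sInf (range Q) + δ by linarith)
  have hmin : ∀ k, Q h ≤ Q k + δ := fun k => by
    have := csInf_le hbdd ⟨k, rfl⟩
    linarith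
  have hδ1 : δ ≤ 1 := min_le_left _ _
  have hδ2 : δ ≤ τ * ε / 2 := min_le_right _ _
  refine ⟨h, ?_, fun a ha => ?_⟩
  · have h1 := (le_abs_self _).trans (hμ.abs_arensFDot_le hB0 hB h)
    have h2 := hμ.norm_mul_apply_abs_le (2 * B) h
    have h3 := hmin 0
    simp only [hQ, mul_zero, map_zero] at h3
    nlinarith
  · have key : ∀ t : ℝ, t * (ν a - μ (h * a)) ≤ δ + t ^ 2 * μ (a * a) / 2 := fun t => by
      have h1 := hmin (h + t • a)
      have h2 : (h + t • a) * (h + t • a) = h * h + (2 * t) • (h * a) + t ^ 2 • (a * a) := by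
        ext x
        simp
        ring
      simp only [hQ, h2, map_add, map_smul, smul_eq_mul] at h1
      linarith
    have h1 := key τ
    have h2 := key (-τ)
    have h3 : τ ^ 2 * μ (a * a) / 2 ≤ τ * ε / 2 := by
      have := mul_le_mul_of_nonneg_left ha (sq_nonneg τ)
      nlinarith
    rw [neg_sq] at h2
    rw [abs_le]
    constructor
    · refine le_of_mul_le_mul_left ?_ hτ
      linarith
    · refine le_of_mul_le_mul_left ?_ hτ
      linarith

theorem dualNonneg.abs_arensMul_sub_le {μ : dual_K} (hμ : dualNonneg μ) {F G : bidual_K}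
    {B R ε : ℝ} {h k : C_K} (hB0 : 0 ≤ B)
    (hB : ∀ ν, |F ν| ≤ B * ‖ν‖) (hR : μ 1 ≤ R) (hε : 0 ≤ ε)
    (hG : ∀ a : C_K, μ (a * a) ≤ R → |_root_.arensFDot C_K G μ a - μ (h * a)| ≤ ε)
    (hF : ∀ a : C_K, μ (a * a) ≤ R → |_root_.arensFDot C_K F μ a - μ (k * a)| ≤ ε)
    (hh : μ (h * h) ≤ R) :
    |arensMul C_K F G μ - μ (k * h)| ≤ (B + 1) * ε := by
  have h1 : ‖_root_.arensFDot C_K G μ - _root_.arensDot C_K μ h‖ ≤ ε := by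
    refine ContinuousLinearMap.opNorm_le_of_unit_norm hε fun a ha => hG a ?_
    refine le_trans (hμ.mono fun x => ?_) hR
    have := a.norm_coe_le_norm x
    rw [ha, Real.norm_eq_abs] at this
    simpa [← sq] using this
  have h2 := hF h hh
  rw [arensFDot_apply] at h2
  have h3 := (hB _).trans (mul_le_mul_of_nonneg_left h1 hB0)
  rw [map_sub, ← arensMul_apply] at h3
  calc _ ≤ |arensMul C_K F G μ - F (_root_.arensDot C_K μ h)| +
        |F (_root_.arensDot C_K μ h) - μ (k * h)| := abs_sub_le _ _ _
    _ ≤ _ := by linarith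

theorem bidual_ext {F G : bidual_K} (h : ∀ μ : dual_K, dualNonneg μ → F μ = G μ) : F = G := by
  ext μ
  obtain ⟨μ₁, μ₂, h₁, h₂, rfl, -⟩ := exists_dualNonneg_sub μ
  rw [map_sub, map_sub, h _ h₁, h _ h₂]

/-- The Arens product on the bidual of `C(K)` is commutative. -/
theorem arensMul_comm (F G : bidual_K) : arensMul C_K F G = arensMul C_K G F := by
  refine bidual_ext fun μ hμ => ?_
  obtain ⟨B, hB0, hB⟩ := exists_abs_bidual_le F
  obtain ⟨B', hB0', hB'⟩ := exists_abs_bidual_le G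
  set R := max (μ 1) (max (4 * (B ^ 2 * μ 1 + 1)) (4 * (B' ^ 2 * μ 1 + 1)))
  refine eq_of_forall_dist_le fun ε hε => ?_
  set η := ε / (B + B' + 2)
  have hη : 0 < η := by positivity
  have hR : μ 1 ≤ R := le_max_left _ _
  obtain ⟨h, hh, hG⟩ := hμ.exists_approx hB0' hB' ((hμ 1 zero_le_one).trans hR) hη
  obtain ⟨k, hk, hF⟩ := hμ.exists_approx hB0 hB ((hμ 1 zero_le_one).trans hR) hη
  have h1 := hμ.abs_arensMul_sub_le hB0 hB hR hη.le hG hF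
    (hh.trans ((le_max_right _ _).trans (le_max_right _ _)))
  have h2 := hμ.abs_arensMul_sub_le hB0' hB' hR hη.le hF hG
    (hk.trans ((le_max_left _ _).trans (le_max_right _ _)))
  rw [mul_comm h k, abs_sub_comm] at h2
  rw [Real.dist_eq]
  refine (abs_sub_le _ (μ (k * h)) _).trans ((add_le_add h1 h2).trans (le_of_eq ?_))
  simp only [η]
  field_simp
  ring

/-- Squares are positive for the Arens product on the bidual of `C(K)`. -/
theorem bidualLe_zero_arensMul_self (F : bidual_K) : bidualLe 0 (arensMul C_K F F) := by
  intro μ hμ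
  rw [zero_apply]
  obtain ⟨B, hB0, hB⟩ := exists_abs_bidual_le F
  set R := max (μ 1) (4 * (B ^ 2 * μ 1 + 1))
  refine le_of_forall_pos_le_add fun ε hε => ?_
  have hR : μ 1 ≤ R := le_max_left _ _
  obtain ⟨h, hh, hF⟩ := hμ.exists_approx hB0 hB ((hμ 1 zero_le_one).trans hR)
    (show 0 < ε / (B + 1) by positivity)
  have h1 := hμ.abs_arensMul_sub_le hB0 hB hR (by positivity) hF hF (hh.trans (le_max_right _ _))
  rw [mul_div_cancel₀ _ (by positivity)] at h1
  have h2 : 0 ≤ μ (h * h) := hμ _ fun x => mul_self_nonneg (h x)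
  linarith [(abs_le.1 h1).1]

theorem bidualLe_zero_arensMul {F G : bidual_K} (hF : bidualLe 0 F) (hG : bidualLe 0 G) :
    bidualLe 0 (arensMul C_K F G) := fun _ hμ => hF _ (hμ.arensFDot hG)

theorem arensMul_assoc (F G H : bidual_K) :
    arensMul C_K (arensMul C_K F G) H = arensMul C_K F (arensMul C_K G H) := by
  refine ContinuousLinearMap.ext fun μ => congrArg F (ContinuousLinearMap.ext fun a =>
    congrArg G (ContinuousLinearMap.ext fun b => congrArg H (ContinuousLinearMap.ext fun c => ?_)))
  exact congrArg μ (mul_assoc a b c)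

theorem arensOne_arensMul (F : bidual_K) : arensMul C_K (arensOne C_K) F = F :=
  ContinuousLinearMap.ext fun μ => congrArg F (ContinuousLinearMap.ext fun a =>
    congrArg μ (one_mul a))

theorem add_arensMul (F G H : bidual_K) :
    arensMul C_K (F + G) H = arensMul C_K F H + arensMul C_K G H := rfl

theorem smul_arensMul (c : ℝ) (F G : bidual_K) :
    arensMul C_K (c • F) G = c • arensMul C_K F G := rfl

variable (K) in
/-- The bidual of `C(K)` as a commutative ring under the Arens product. -/
noncomputable abbrev arensCommRing : CommRing bidual_K where
  __ := (inferInstance : AddCommGroup bidual_K)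
  mul F G := arensMul C_K F G
  one := arensOne C_K
  mul_assoc := arensMul_assoc
  one_mul := arensOne_arensMul
  mul_one F := (arensMul_comm F _).trans (arensOne_arensMul F)
  left_distrib F G H := by
    change arensMul C_K F (G + H) = arensMul C_K F G + arensMul C_K F H
    simp only [arensMul_comm F, add_arensMul]
  right_distrib := add_arensMul
  zero_mul F := rfl
  mul_zero F := arensMul_comm F 0
  mul_comm := arensMul_comm

theorem abs_apply_le_of_bidualLe_one {F : bidual_K} (h0 : bidualLe 0 F)
    (h1 : bidualLe F (arensOne C_K)) (μ : dual_K) : |F μ| ≤ 3 * ‖μ‖ := by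
  obtain ⟨μ₁, μ₂, h₁, h₂, rfl, h⟩ := exists_dualNonneg_sub μ
  have a1 : 0 ≤ F μ₁ := h0 _ h₁
  have a2 : 0 ≤ F μ₂ := h0 _ h₂
  have a3 : F μ₁ ≤ μ₁ 1 := h1 _ h₁
  have a4 : F μ₂ ≤ μ₂ 1 := h1 _ h₂
  rw [map_sub]
  refine le_trans ?_ h
  rw [abs_le]
  constructor <;> linarith

/-- A weak* closed ideal of the bidual of `C(K)` has, among its elements between `0` and `1`, a
greatest one. -/
theorem exists_greatest_bidual (M : Set dual_K)
    (hM : ∀ F G : bidual_K, (∀ μ ∈ M, G μ = 0) → ∀ μ ∈ M, arensMul C_K F G μ = 0) :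
    ∃ e : bidual_K, (∀ μ ∈ M, e μ = 0) ∧ bidualLe 0 e ∧ bidualLe e (arensOne C_K) ∧
      ∀ F : bidual_K, (∀ μ ∈ M, F μ = 0) → bidualLe 0 F → bidualLe F (arensOne C_K) →
        bidualLe F e := by
  let _ := arensCommRing K
  let J : Set bidual_K :=
    {F | (∀ μ ∈ M, F μ = 0) ∧ bidualLe 0 F ∧ bidualLe F (arensOne C_K)}
  let A : J → Set (WeakDual ℝ dual_K) := fun F =>
    {G | WeakDual.toStrongDual G ∈ J ∧ bidualLe F.1 (WeakDual.toStrongDual G)}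
  have hclosed : ∀ F, IsClosed (A F) := by
    intro F
    have : A F = (⋂ μ ∈ M, {G : WeakDual ℝ dual_K | G μ = 0}) ∩
        ((⋂ (μ : dual_K) (_ : dualNonneg μ), {G : WeakDual ℝ dual_K | 0 ≤ G μ}) ∩
          (⋂ (μ : dual_K) (_ : dualNonneg μ), {G : WeakDual ℝ dual_K | G μ ≤ μ 1})) ∩
        (⋂ (μ : dual_K) (_ : dualNonneg μ), {G : WeakDual ℝ dual_K | F.1 μ ≤ G μ}) := by
      ext G
      simp only [mem_inter_iff, mem_iInter]
      rfl
    rw [this]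
    refine ((isClosed_biInter fun μ _ => ?_).inter ((isClosed_biInter fun μ _ => ?_).inter
      (isClosed_biInter fun μ _ => ?_))).inter (isClosed_biInter fun μ _ => ?_)
    · exact isClosed_eq (WeakDual.eval_continuous μ) continuous_const
    · exact isClosed_le continuous_const (WeakDual.eval_continuous μ)
    · exact isClosed_le (WeakDual.eval_continuous μ) continuous_const
    · exact isClosed_le continuous_const (WeakDual.eval_continuous μ)
  have hdir : Directed (· ⊇ ·) A := by
    rintro ⟨F, hF, hF0, hF1⟩ ⟨G, hG, hG0, hG1⟩
    have hF1' : bidualLe 0 (1 - F) := fun μ hμ => sub_nonneg.2 (hF1 μ hμ)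
    have hG1' : bidualLe 0 (1 - G) := fun μ hμ => sub_nonneg.2 (hG1 μ hμ)
    have e1 : (F + G - F * G) - F = (1 - F) * G := by ring
    have e2 : (F + G - F * G) - G = F * (1 - G) := by ring
    have e3 : 1 - (F + G - F * G) = (1 - F) * (1 - G) := by ring
    have hFH : bidualLe F (F + G - F * G) := fun μ hμ => by
      have := bidualLe_zero_arensMul hF1' hG0 μ hμ
      change 0 ≤ ((1 - F) * G) μ at this
      rw [← e1] at this
      exact sub_nonneg.1 this
    have hGH : bidualLe G (F + G - F * G) := fun μ hμ => by
      have := bidualLe_zero_arensMul hF0 hG1' μ hμ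
      change 0 ≤ (F * (1 - G)) μ at this
      rw [← e2] at this
      exact sub_nonneg.1 this
    have hH1 : bidualLe (F + G - F * G) (arensOne C_K) := fun μ hμ => by
      have := bidualLe_zero_arensMul hF1' hG1' μ hμ
      change 0 ≤ ((1 - F) * (1 - G)) μ at this
      rw [← e3] at this
      exact sub_nonneg.1 this
    refine ⟨⟨F + G - F * G, fun μ hμ => ?_, fun μ hμ => (hF0 μ hμ).trans (hFH μ hμ), hH1⟩,
      fun H hH => ⟨hH.1, fun μ hμ => (hFH μ hμ).trans (hH.2 μ hμ)⟩,
      fun H hH => ⟨hH.1, fun μ hμ => (hGH μ hμ).trans (hH.2 μ hμ)⟩⟩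
    have h := hM F G hG μ hμ
    change F μ + G μ - arensMul C_K F G μ = 0
    rw [hF μ hμ, hG μ hμ, h]
    norm_num
  have : Nonempty J := ⟨0, fun _ _ => rfl, fun _ _ => le_rfl, fun μ hμ => hμ 1 zero_le_one⟩
  have hne : ∀ F, (A F).Nonempty := fun F => ⟨StrongDual.toWeakDual F.1, F.2, fun _ _ => le_rfl⟩
  obtain ⟨e, he⟩ := WeakDual.nonempty_iInter_of_directed (V := StrongDual ℝ C_K) A hdir hne hclosed 3 (by norm_num)
    (fun F G hG => abs_apply_le_of_bidualLe_one hG.1.2.1 hG.1.2.2)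
  rw [mem_iInter] at he
  have heJ := (he ⟨0, fun _ _ => rfl, fun _ _ => le_rfl, fun μ hμ => hμ 1 zero_le_one⟩).1
  exact ⟨WeakDual.toStrongDual e, heJ.1, heJ.2.1, heJ.2.2,
    fun F hF hF0 hF1 => (he ⟨F, hF, hF0, hF1⟩).2⟩

theorem eq_zero_of_arensMul_self_eq_zero {H : bidual_K} (hH : arensMul C_K H H = 0) : H = 0 := by
  let _ := arensCommRing K
  refine bidual_ext fun μ hμ => ?_
  have key : ∀ t : ℝ, 0 ≤ μ 1 + 2 * t * H μ := fun t => by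
    have h := bidualLe_zero_arensMul_self (arensOne C_K + t • H) μ hμ
    have e : arensMul C_K (arensOne C_K + t • H) (arensOne C_K + t • H) =
        arensOne C_K + (2 * t) • H := by
      rw [add_arensMul, arensOne_arensMul, smul_arensMul, arensMul_comm H, add_arensMul,
        arensOne_arensMul, smul_arensMul, hH]
      module
    rw [e] at h
    simpa [arensOne_apply] using h
  by_contra hne
  change H μ ≠ 0 at hne
  have := key (-(μ 1 + 1) / (2 * H μ))
  field_simp at this
  linarith

/-- A weak* closed ideal of the bidual of `C(K)` is generated by an idempotent. -/
theorem exists_idempotent_of_annihilator (M : Set dual_K)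
    (hM : ∀ F G : bidual_K, (∀ μ ∈ M, G μ = 0) → ∀ μ ∈ M, arensMul C_K F G μ = 0) :
    ∃ e : bidual_K, (∀ μ ∈ M, e μ = 0) ∧ arensMul C_K e e = e ∧
      ∀ F : bidual_K, (∀ μ ∈ M, F μ = 0) → arensMul C_K e F = F := by
  let _ := arensCommRing K
  obtain ⟨e, heM, he0, he1, hmax⟩ := exists_greatest_bidual M hM
  have he1' : bidualLe 0 (1 - e) := fun μ hμ => sub_nonneg.2 (he1 μ hμ)
  have hee : e * e = e := by
    have e1 : 1 - (e + e - e * e) = (1 - e) * (1 - e) := by ring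
    have e2 : (e + e - e * e) - e = e * (1 - e) := by ring
    have h1 := bidualLe_zero_arensMul he0 he1'
    change bidualLe 0 (e * (1 - e)) at h1
    have h2 := bidualLe_zero_arensMul he1' he1'
    change bidualLe 0 ((1 - e) * (1 - e)) at h2
    have h3 := hmax (e + e - e * e) (fun μ hμ => by
        change e μ + e μ - arensMul C_K e e μ = 0
        rw [heM μ hμ, hM e e heM μ hμ]
        norm_num)
      (fun μ hμ => by
        have := h1 μ hμ
        rw [← e2] at this
        exact (he0 μ hμ).trans (sub_nonneg.1 this))
      (fun μ hμ => by
        have := h2 μ hμ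
        rw [← e1] at this
        exact sub_nonneg.1 this)
    refine bidual_ext fun μ hμ => ?_
    have h4 := h3 μ hμ
    have h5 := h1 μ hμ
    rw [← e2] at h5
    change 0 ≤ e μ + e μ - (e * e) μ - e μ at h5
    change e μ + e μ - (e * e) μ ≤ e μ at h4
    linarith
  refine ⟨e, heM, hee, fun F hF => ?_⟩
  set H := (1 - e) * F with hH
  have hHM : ∀ μ ∈ M, H μ = 0 := hM _ _ hF
  have hHH : bidualLe 0 (H * H) := bidualLe_zero_arensMul_self H
  obtain ⟨B, hB0, hB⟩ := exists_abs_bidual_le (H * H)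
  set c : ℝ := (B + 1)⁻¹
  have hc : 0 < c := by positivity
  have hcH := hmax (c • (H * H))
    (fun μ hμ => by
      change c • (arensMul C_K H H μ) = 0
      rw [hM H H hHM μ hμ, smul_zero])
    (fun μ hμ => mul_nonneg hc.le (hHH μ hμ))
    (fun μ hμ => by
      change c * (H * H) μ ≤ μ 1
      have h1 := (le_abs_self _).trans (hB μ)
      have h2 := mul_le_mul_of_nonneg_left hμ.norm_le hB0
      have h3 := hμ 1 zero_le_one
      rw [inv_mul_le_iff₀ (by positivity)]
      linarith)
  have hHe : (1 - e) * (H * H) = H * H := by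
    rw [hH]
    linear_combination (F * F * (1 - e)) * hee
  have hHH0 : H * H = 0 := by
    refine bidual_ext fun μ hμ => le_antisymm ?_ (hHH μ hμ)
    have h := hcH _ (hμ.arensFDot he1')
    change arensMul C_K (c • (H * H)) (1 - e) μ ≤ (e * (1 - e)) μ at h
    have h0 : e * (1 - e) = 0 := by linear_combination -hee
    rw [smul_arensMul, arensMul_comm, h0] at h
    change c * ((1 - e) * (H * H)) μ ≤ 0 at h
    rw [hHe] at h
    exact nonpos_of_mul_nonpos_right h hc
  have h0 : H = 0 := eq_zero_of_arensMul_self_eq_zero hHH0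
  change e * F = F
  linear_combination -h0 + hH

end ArensProduct

section RieszSpace

theorem abs_le_iff_neg_le_and_le {V : Type*} [Lattice V] [AddCommGroup V]
    [IsOrderedAddMonoid V] {x y : V} : |x| ≤ y ↔ -y ≤ x ∧ x ≤ y := by
  rw [abs_le', neg_le, and_comm]

variable {V : Type*} [Lattice V] [AddCommGroup V] [Module ℝ V] [PosSMulMono ℝ V]

theorem abs_smul_of_pos {c : ℝ} (hc : 0 < c) (x : V) : |c • x| = c • |x| := by
  refine le_antisymm (abs_le'.2 ⟨smul_le_smul_of_nonneg_left (le_abs_self x) hc.le, ?_⟩) ?_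
  · rw [← smul_neg]
    exact smul_le_smul_of_nonneg_left (neg_le_abs x) hc.le
  · rw [← le_inv_smul_iff_of_pos hc]
    refine abs_le'.2 ⟨?_, ?_⟩ <;> rw [le_inv_smul_iff_of_pos hc]
    · exact le_abs_self _
    · rw [smul_neg]
      exact neg_le_abs _

theorem abs_smul_eq_abs_smul_abs (c : ℝ) (x : V) : |c • x| = |c| • |x| := by
  rcases lt_trichotomy c 0 with hc | rfl | hc
  · rw [abs_of_neg hc, ← abs_neg, ← neg_smul, abs_smul_of_pos (neg_pos.2 hc)]
  · rw [zero_smul, _root_.abs_zero (α := ℝ), zero_smul, abs, neg_zero, sup_idem]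
  · rw [abs_of_pos hc, abs_smul_of_pos hc]

variable [IsOrderedAddMonoid V]

theorem isCentral_of_abs_le (T : V →ₗ[ℝ] V) {c : ℝ} (hT : ∀ x, |T x| ≤ c • |x|) :
    IsCentral fun x => T x := by
  have h0 : ∀ x : V, 0 ≤ |x| := abs_nonneg
  have hT' : ∀ x, |T x| ≤ max c 1 • |x| := fun x =>
    (hT x).trans (smul_le_smul_of_nonneg_right (le_max_left _ _) (h0 x))
  have hc : 0 < max c 1 := lt_max_of_lt_right one_pos
  refine ⟨⟨T.isLinear, fun a b => ?_, fun x y hxy => ?_⟩, c, fun x hx => ?_⟩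
  · refine ⟨-(max c 1 • (|a| + |b|)), max c 1 • (|a| + |b|), fun x hax hxb => ?_⟩
    have hx : |x| ≤ |a| + |b| := abs_le'.2
      ⟨hxb.trans ((le_abs_self b).trans (le_add_of_nonneg_left (h0 a))),
        (neg_le_neg hax).trans ((neg_le_abs a).trans (le_add_of_nonneg_right (h0 b)))⟩
    exact abs_le_iff_neg_le_and_le.1 ((hT' x).trans (smul_le_smul_of_nonneg_left hx hc.le))
  · refine le_antisymm ?_ (le_inf (h0 _) (h0 _))
    rw [← smul_zero (max c 1), ← hxy, ← inv_smul_le_iff_of_pos hc]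
    refine le_inf ?_ ?_ <;> rw [inv_smul_le_iff_of_pos hc]
    · exact inf_le_left.trans (hT' x)
    · refine inf_le_right.trans ?_
      simpa using smul_le_smul_of_nonneg_right (le_max_right c 1) (h0 y)
  · have := hT x
    rw [abs_of_nonneg hx] at this
    exact abs_le_iff_neg_le_and_le.1 this

theorem IsCentral.exists_abs_le {T : V → V} (hT : IsCentral T) :
    ∃ c : ℝ, 0 ≤ c ∧ ∀ x, |T x| ≤ c • |x| := by
  obtain ⟨⟨hlin, -, -⟩, c, hc⟩ := hT
  refine ⟨max c 0, le_max_right _ _, fun x => ?_⟩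
  have key : ∀ y, 0 ≤ y → |T y| ≤ max c 0 • y := fun y hy =>
    (abs_le_iff_neg_le_and_le.2 (hc y hy)).trans (smul_le_smul_of_nonneg_right (le_max_left _ _) hy)
  calc |T x| = |T x⁺ + -T x⁻| := by
        rw [← sub_eq_add_neg, ← hlin.map_sub, posPart_sub_negPart]
    _ ≤ |T x⁺| + |-T x⁻| := abs_add_le _ _
    _ = |T x⁺| + |T x⁻| := by rw [abs_neg]
    _ ≤ max c 0 • x⁺ + max c 0 • x⁻ :=
        add_le_add (key _ (posPart_nonneg x)) (key _ (negPart_nonneg x))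
    _ = max c 0 • |x| := by rw [← smul_add, posPart_add_negPart]

end RieszSpace

namespace IsOrderDual

variable {X Y : Type*} [Lattice X] [AddCommGroup X] [Module ℝ X]
  [Lattice Y] [AddCommGroup Y] [Module ℝ Y] {P : Y →ₗ[ℝ] X →ₗ[ℝ] ℝ}

theorem apply_mono (hP : IsOrderDual X Y fun y x => P y x) {y z : Y} (h : y ≤ z) {x : X}
    (hx : 0 ≤ x) : P y x ≤ P z x := (hP.le_iff y z).1 h x hx

theorem ext_of_nonneg (hP : IsOrderDual X Y fun y x => P y x) {y z : Y}
    (h : ∀ x, 0 ≤ x → P y x = P z x) : y = z :=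
  le_antisymm ((hP.le_iff y z).2 fun x hx => (h x hx).le)
    ((hP.le_iff z y).2 fun x hx => (h x hx).ge)

theorem apply_nonneg (hP : IsOrderDual X Y fun y x => P y x) {y : Y} (hy : 0 ≤ y) {x : X}
    (hx : 0 ≤ x) : 0 ≤ P y x := by
  simpa using hP.apply_mono hy hx

variable [IsOrderedAddMonoid X]

theorem apply_mono_right (hP : IsOrderDual X Y fun y x => P y x) {y : Y} (hy : 0 ≤ y) {a b : X}
    (h : a ≤ b) : P y a ≤ P y b := by
  have := hP.apply_nonneg hy (sub_nonneg.2 h)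
  rwa [map_sub, sub_nonneg] at this

/-- Positive functionals are order bounded, hence represented in the order dual. -/
theorem exists_eq_of_nonneg (hP : IsOrderDual X Y fun y x => P y x) (ψ : X →ₗ[ℝ] ℝ)
    (hψ : ∀ x, 0 ≤ x → 0 ≤ ψ x) : ∃ y, P y = ψ := by
  have hmono : ∀ a b, a ≤ b → ψ a ≤ ψ b := fun a b h => by
    have := hψ (b - a) (sub_nonneg.2 h)
    rw [map_sub] at this
    linarith
  obtain ⟨y, hy⟩ := hP.surj ψ ψ.isLinear fun a b =>
    ⟨ψ a, ψ b, fun x ha hb => ⟨hmono _ _ ha, hmono _ _ hb⟩⟩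
  exact ⟨y, LinearMap.ext hy⟩

theorem abs_apply_le (hP : IsOrderDual X Y fun y x => P y x) (y : Y) (x : X) :
    |P y x| ≤ P |y| |x| := by
  have key : ∀ a, 0 ≤ a → |P y a| ≤ P |y| a := fun a ha =>
    abs_le'.2 ⟨hP.apply_mono (le_abs_self y) ha, by simpa using hP.apply_mono (neg_le_abs y) ha⟩
  have h := abs_sub (P y x⁺) (P y x⁻)
  rw [← map_sub, posPart_sub_negPart] at h
  rw [← posPart_add_negPart x, map_add]
  exact h.trans (add_le_add (key _ (posPart_nonneg x)) (key _ (negPart_nonneg x)))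

variable [PosSMulMono ℝ X]

/-- Order duals are Dedekind complete. -/
theorem exists_isLUB (hP : IsOrderDual X Y fun y x => P y x) (s : Set Y) (hs : s.Nonempty)
    (hbdd : BddAbove s) : ∃ y, IsLUB s y := by
  obtain ⟨u, hu⟩ := hbdd
  rw [← upperBounds_supClosure] at hu
  obtain ⟨z, hz⟩ := hs
  replace hz := subset_supClosure hz
  obtain ⟨ψ, hψ⟩ := exists_isLUB_image_apply (s := P '' supClosure s) ⟨_, z, hz, rfl⟩
    (by
      rintro _ ⟨y₁, hy₁, rfl⟩ _ ⟨y₂, hy₂, rfl⟩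
      obtain ⟨w, hw, h₁, h₂⟩ := supClosed_supClosure.directedOn y₁ hy₁ y₂ hy₂
      exact ⟨P w, ⟨w, hw, rfl⟩, fun a ha => ⟨hP.apply_mono h₁ ha, hP.apply_mono h₂ ha⟩⟩)
    (by
      rintro a ha
      refine ⟨P u a, ?_⟩
      rintro _ ⟨_, ⟨y, hy, rfl⟩, rfl⟩
      exact hP.apply_mono (hu hy) ha)
  obtain ⟨d, hd⟩ := hP.exists_eq_of_nonneg (ψ - P z) fun a ha =>
    sub_nonneg.2 ((hψ a ha).1 ⟨P z, ⟨z, hz, rfl⟩, rfl⟩)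
  have hzd : P (z + d) = ψ := by rw [map_add, hd, add_sub_cancel]
  refine ⟨z + d, isLUB_supClosure.1 ⟨fun y hy => (hP.le_iff _ _).2 fun a ha => ?_,
    fun v hv => (hP.le_iff _ _).2 fun a ha => ?_⟩⟩
  · rw [hzd]
    exact (hψ a ha).1 ⟨P y, ⟨y, hy, rfl⟩, rfl⟩
  · rw [hzd]
    refine (hψ a ha).2 ?_
    rintro _ ⟨_, ⟨y, hy, rfl⟩, rfl⟩
    exact hP.apply_mono (hv hy) ha

variable [IsOrderedAddMonoid Y]

/-- The Riesz–Kantorovich formula for the modulus. -/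
theorem abs_apply_le_of_forall_abs_le (hP : IsOrderDual X Y fun y x => P y x) {y : Y} {a : X}
    (ha : 0 ≤ a) {R : ℝ} (hR : ∀ x, |x| ≤ a → P y x ≤ R) : P |y| a ≤ R := by
  obtain ⟨ψ, hψ⟩ := exists_isLUB_image_Icc (P y) fun a => by
    refine ⟨P |y| a, ?_⟩
    rintro _ ⟨b, ⟨hb0, hba⟩, rfl⟩
    refine (hP.apply_mono (le_abs_self y) hb0).trans ?_
    have := hP.apply_nonneg (abs_nonneg y) (sub_nonneg.2 hba)
    rw [map_sub] at this
    linarith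
  obtain ⟨w, rfl⟩ := hP.exists_eq_of_nonneg ψ fun b hb =>
    (hψ b hb).1 ⟨0, ⟨le_rfl, hb⟩, map_zero _⟩
  have hw : y ⊔ 0 ≤ w := sup_le
    ((hP.le_iff _ _).2 fun b hb => (hψ b hb).1 ⟨b, ⟨hb, le_rfl⟩, rfl⟩)
    ((hP.le_iff _ _).2 fun b hb => by
      simpa using (hψ b hb).1 ⟨0, ⟨le_rfl, hb⟩, map_zero _⟩)
  have hwa : P w a ≤ (R + P y a) / 2 := by
    refine (hψ a ha).2 ?_
    rintro _ ⟨b, ⟨hb0, hba⟩, rfl⟩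
    have := hR (b + b - a) (abs_le'.2 ⟨?_, ?_⟩)
    · rw [map_sub, map_add] at this
      linarith
    · rw [sub_le_iff_le_add]
      exact add_le_add hba hba
    · rw [neg_sub, sub_le_self_iff]
      exact add_nonneg hb0 hb0
  have h1 : |y| = (y ⊔ 0) + (y ⊔ 0) - y := by
    have h2 := posPart_sub_negPart y
    have h3 := posPart_add_negPart y
    change |y| = y⁺ + y⁺ - y
    rw [← h3]
    nth_rewrite 5 [← h2]
    abel
  have h2 := hP.apply_mono hw ha
  rw [h1, map_sub, map_add, LinearMap.sub_apply, LinearMap.add_apply]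
  linarith

end IsOrderDual

section CenterAction

variable {K V : Type*} [TopologicalSpace K] [CompactSpace K]
  [Lattice V] [AddCommGroup V] [Module ℝ V]

/-- A positive action of `C(K)` on a Riesz space `V` such that every order interval `[-f, f]` is
contained in the orbit of `f` under the unit ball of `C(K)`. -/
structure IsCyclicAction (Θ : C(K, ℝ) →ₐ[ℝ] Module.End ℝ V) : Prop where
  nonneg : ∀ {h : C(K, ℝ)} {f : V}, 0 ≤ h → 0 ≤ f → 0 ≤ Θ h f
  exists_eq : ∀ {f g : V}, 0 ≤ f → |g| ≤ f → ∃ h : C(K, ℝ), ‖h‖ ≤ 1 ∧ Θ h f = g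

theorem apply_one_eq_apply_one_of_abs_le [T2Space K] (β : C(K, ℝ) →ₗ[ℝ] C(K, ℝ) →ₗ[ℝ] ℝ)
    {ν : C(K, ℝ) →L[ℝ] ℝ} (hν : dualNonneg ν) {c : ℝ} (hc : 0 ≤ c)
    (hβ : ∀ a b, |β a b| ≤ c * ν (|a| * |b|)) (h : C(K, ℝ)) : β 1 h = β h 1 := by
  refine eq_of_forall_dist_le fun ε hε => ?_
  set δ := ε / (2 * c * ν 1 + 1) with hδ
  have hν1 : 0 ≤ ν 1 := hν 1 zero_le_one
  have hδ0 : 0 < δ := by positivity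
  have hδε : 2 * c * ν 1 * δ ≤ ε := by
    rw [hδ, ← mul_div_assoc, div_le_iff₀ (by positivity)]
    nlinarith
  obtain ⟨t, ht⟩ := isCompact_univ.elim_finite_subcover (fun y : K => {x | |h x - h y| < δ})
    (fun y => isOpen_lt (by fun_prop) continuous_const)
    (fun x _ => mem_iUnion.2 ⟨x, by simpa using hδ0⟩)
  obtain ⟨ρ, hρ⟩ := PartitionOfUnity.exists_isSubordinate isClosed_univ
    (fun y : t => {x | |h x - h y| < δ})
    (fun y => isOpen_lt (by fun_prop) continuous_const)
    (fun x hx => by simpa using ht hx)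
  have hsum : ∑ y, ρ y = 1 := by
    ext x
    have := ρ.sum_eq_one (mem_univ x)
    rw [finsum_eq_sum_of_fintype] at this
    simpa using this
  have hsmall : ∀ y : t, |h - (h y) • (1 : C(K, ℝ))| * ρ y ≤ δ • ρ y := fun y x => by
    have h0 := ρ.nonneg y x
    by_cases hx : ρ y x = 0
    · simp [hx]
    · have : |h x - h y| < δ := hρ y (subset_tsupport _ hx)
      simpa using mul_le_mul_of_nonneg_right this.le h0
  have hterm : ∀ y : t, |β 1 (h * ρ y) - β h (ρ y)| ≤ 2 * c * δ * ν (ρ y) := fun y => by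
    set k := h - (h y) • (1 : C(K, ℝ)) with hk
    have e : β 1 (h * ρ y) - β h (ρ y) = β 1 (k * ρ y) - β k (ρ y) := by
      simp only [hk, sub_mul, smul_mul_assoc, one_mul, map_sub, map_smul, LinearMap.sub_apply,
        LinearMap.smul_apply]
      ring
    have hρy : |ρ y| = ρ y := abs_of_nonneg fun x => ρ.nonneg y x
    have h1 := hβ 1 (k * ρ y)
    have h2 := hβ k (ρ y)
    have e1 : |(1 : C(K, ℝ))| * |k * ρ y| = |k| * ρ y := by
      ext x
      simp [abs_mul, abs_of_nonneg (ρ.nonneg y x)]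
    rw [e1] at h1
    rw [hρy] at h2
    have h3 := mul_le_mul_of_nonneg_left (hν.mono (hsmall y)) hc
    rw [map_smul, smul_eq_mul] at h3
    rw [e]
    refine (abs_sub _ _).trans ?_
    linarith
  have htot : β 1 h - β h 1 = ∑ y, (β 1 (h * ρ y) - β h (ρ y)) := by
    rw [Finset.sum_sub_distrib, ← map_sum, ← map_sum, ← Finset.mul_sum, hsum, mul_one]
  rw [Real.dist_eq, htot]
  calc _ ≤ ∑ y, |β 1 (h * ρ y) - β h (ρ y)| := Finset.abs_sum_le_sum_abs _ _
    _ ≤ ∑ y, 2 * c * δ * ν (ρ y) := Finset.sum_le_sum fun y _ => hterm y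
    _ = 2 * c * ν 1 * δ := by rw [← Finset.mul_sum, ← map_sum, hsum]; ring
    _ ≤ ε := hδε

theorem algHom_apply_comm {V : Type*} [AddCommGroup V] [Module ℝ V]
    {K : Type*} [TopologicalSpace K] (Θ : C(K, ℝ) →ₐ[ℝ] Module.End ℝ V) (h k : C(K, ℝ)) (f : V) :
    Θ h (Θ k f) = Θ k (Θ h f) := by
  rw [← Module.End.mul_apply, ← map_mul, mul_comm, map_mul, Module.End.mul_apply]

namespace IsCyclicAction

variable [IsOrderedAddMonoid V] {Θ : C(K, ℝ) →ₐ[ℝ] Module.End ℝ V}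

theorem mono_left (hΘ : IsCyclicAction Θ) {h k : C(K, ℝ)} (hk : h ≤ k) {f : V} (hf : 0 ≤ f) :
    Θ h f ≤ Θ k f := by
  have := hΘ.nonneg (sub_nonneg.2 hk) hf
  rwa [map_sub, LinearMap.sub_apply, sub_nonneg] at this

theorem abs_apply_le (hΘ : IsCyclicAction Θ) (h : C(K, ℝ)) (f : V) : |Θ h f| ≤ Θ |h| |f| := by
  have key : ∀ a, 0 ≤ a → |Θ h a| ≤ Θ |h| a := fun a ha =>
    abs_le'.2 ⟨hΘ.mono_left (le_abs_self h) ha, by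
      simpa using hΘ.mono_left (neg_le_abs h) ha⟩
  calc |Θ h f| = |Θ h f⁺ + -Θ h f⁻| := by rw [← sub_eq_add_neg, ← map_sub, posPart_sub_negPart]
    _ ≤ |Θ h f⁺| + |-Θ h f⁻| := abs_add_le _ _
    _ ≤ Θ |h| f⁺ + Θ |h| f⁻ := by
        rw [abs_neg]
        exact add_le_add (key _ (posPart_nonneg f)) (key _ (negPart_nonneg f))
    _ = Θ |h| |f| := by rw [← map_add, posPart_add_negPart]

theorem abs_apply_le_norm_smul (hΘ : IsCyclicAction Θ) (h : C(K, ℝ)) (f : V) :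
    |Θ h f| ≤ ‖h‖ • |f| := by
  refine (hΘ.abs_apply_le h f).trans ?_
  simpa using hΘ.mono_left h.abs_le_norm_smul_one (abs_nonneg f)

variable {W : Type*} [Lattice W] [AddCommGroup W] [IsOrderedAddMonoid W] [Module ℝ W]
  {P : W →ₗ[ℝ] V →ₗ[ℝ] ℝ}

theorem abs_pairing_le (hΘ : IsCyclicAction Θ) (hP : IsOrderDual V W fun x f => P x f)
    (x : W) {f : V} (hf : 0 ≤ f) (h : C(K, ℝ)) : |P x (Θ h f)| ≤ P |x| (Θ |h| f) := by
  have h1 := hP.apply_mono_right (abs_nonneg x) (hΘ.abs_apply_le h f)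
  rw [abs_of_nonneg hf] at h1
  exact (hP.abs_apply_le x (Θ h f)).trans h1

theorem abs_pairing_le_mul_norm (hΘ : IsCyclicAction Θ) (hP : IsOrderDual V W fun x f => P x f)
    (x : W) (f : V) (h : C(K, ℝ)) : |P x (Θ h f)| ≤ P |x| |f| * ‖h‖ := by
  have h1 := hP.apply_mono_right (abs_nonneg x) (hΘ.abs_apply_le_norm_smul h f)
  rw [map_smul, smul_eq_mul, mul_comm] at h1
  exact (hP.abs_apply_le x (Θ h f)).trans h1

/-- The functional `h ↦ ⟨x, h f⟩` on `C(K)`. -/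
noncomputable def orbitFunctional (hΘ : IsCyclicAction Θ)
    (hP : IsOrderDual V W fun x f => P x f) (x : W) (f : V) : C(K, ℝ) →L[ℝ] ℝ :=
  (P x ∘ₗ LinearMap.applyₗ f ∘ₗ Θ.toLinearMap).mkContinuous (P |x| |f|)
    (hΘ.abs_pairing_le_mul_norm hP x f)

theorem orbitFunctional_apply (hΘ : IsCyclicAction Θ) (hP : IsOrderDual V W fun x f => P x f)
    (x : W) (f : V) (h : C(K, ℝ)) : hΘ.orbitFunctional hP x f h = P x (Θ h f) := rfl

theorem norm_orbitFunctional_le (hΘ : IsCyclicAction Θ)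
    (hP : IsOrderDual V W fun x f => P x f) (x : W) (f : V) :
    ‖hΘ.orbitFunctional hP x f‖ ≤ P |x| |f| :=
  LinearMap.mkContinuous_norm_le _ (hP.apply_nonneg (abs_nonneg x) (abs_nonneg f)) _

theorem pairing_abs_le_norm_orbitFunctional [PosSMulMono ℝ V] (hΘ : IsCyclicAction Θ)
    (hP : IsOrderDual V W fun x f => P x f) (x : W) {f : V} (hf : 0 ≤ f) :
    P |x| f ≤ ‖hΘ.orbitFunctional hP x f‖ := by
  refine hP.abs_apply_le_of_forall_abs_le hf fun g hg => ?_
  obtain ⟨h, hh, rfl⟩ := hΘ.exists_eq hf hg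
  rw [← hΘ.orbitFunctional_apply hP]
  refine (le_abs_self _).trans (((hΘ.orbitFunctional hP x f).le_opNorm h).trans ?_)
  exact mul_le_of_le_one_right (norm_nonneg _) hh

theorem orbitFunctional_apply_eq_arensDot (hΘ : IsCyclicAction Θ)
    (hP : IsOrderDual V W fun x f => P x f) (x : W) (f : V) (h : C(K, ℝ)) :
    hΘ.orbitFunctional hP x (Θ h f) = arensDot C(K, ℝ) (hΘ.orbitFunctional hP x f) h := by
  ext k
  rw [arensDot_apply, orbitFunctional_apply, orbitFunctional_apply, map_mul,
    Module.End.mul_apply, algHom_apply_comm]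

theorem arensMul_orbitFunctional_eq_zero (hΘ : IsCyclicAction Θ)
    (hP : IsOrderDual V W fun x f => P x f) (F : (C(K, ℝ) →L[ℝ] ℝ) →L[ℝ] ℝ)
    {G : (C(K, ℝ) →L[ℝ] ℝ) →L[ℝ] ℝ} (hG : ∀ x f, G (hΘ.orbitFunctional hP x f) = 0)
    (x : W) (f : V) : arensMul C(K, ℝ) F G (hΘ.orbitFunctional hP x f) = 0 := by
  have : arensFDot C(K, ℝ) G (hΘ.orbitFunctional hP x f) = 0 := by
    ext h
    rw [arensFDot_apply, ← orbitFunctional_apply_eq_arensDot, hG]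
    rfl
  rw [arensMul_apply, this, map_zero]

theorem exists_transpose (hΘ : IsCyclicAction Θ) (hP : IsOrderDual V W fun x f => P x f) :
    ∃ T : C(K, ℝ) → W → W, ∀ h x f, P (T h x) f = P x (Θ h f) := by
  have : ∀ h x, ∃ y, ∀ f, P y f = P x (Θ h f) := fun h x => by
    obtain ⟨y, hy⟩ := hP.surj (P x ∘ₗ Θ h) (P x ∘ₗ Θ h).isLinear fun a b => by
      refine ⟨-(P |x| (|a| + |b|) * ‖h‖), P |x| (|a| + |b|) * ‖h‖, fun f ha hb => ?_⟩
      have hf : |f| ≤ |a| + |b| := abs_le'.2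
        ⟨hb.trans ((le_abs_self b).trans (le_add_of_nonneg_left (abs_nonneg a))),
          (neg_le_neg ha).trans ((neg_le_abs a).trans (le_add_of_nonneg_right (abs_nonneg b)))⟩
      exact abs_le.1 ((hΘ.abs_pairing_le_mul_norm hP x f h).trans
        (mul_le_mul_of_nonneg_right (hP.apply_mono_right (abs_nonneg x) hf) (norm_nonneg h)))
    exact ⟨y, hy⟩
  choose T hT using this
  exact ⟨T, hT⟩

/-- Central operators on `W` commute with the transposes of the operators `Θ h`. -/
theorem map_transpose [T2Space K] (hΘ : IsCyclicAction Θ)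
    (hP : IsOrderDual V W fun x f => P x f) {S : W →ₗ[ℝ] W} {c : ℝ} (hc : 0 ≤ c)
    (hS : ∀ x, |S x| ≤ c • |x|) {T : C(K, ℝ) → W → W}
    (hT : ∀ h x f, P (T h x) f = P x (Θ h f)) (h : C(K, ℝ)) (x : W) :
    S (T h x) = T h (S x) := by
  refine hP.ext_of_nonneg fun f hf => ?_
  have hadd : ∀ a b, T (a + b) x = T a x + T b x := fun a b => hP.inj _ _ fun g => by
    simp [hT]
  have hsmul : ∀ (t : ℝ) a, T (t • a) x = t • T a x := fun t a => hP.inj _ _ fun g => by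
    simp [hT]
  let β : C(K, ℝ) →ₗ[ℝ] C(K, ℝ) →ₗ[ℝ] ℝ := LinearMap.mk₂ ℝ (fun a b => P (S (T b x)) (Θ a f))
    (fun a b d => by simp) (fun t a b => by simp) (fun a b d => by simp [hadd])
    (fun t a b => by simp [hsmul])
  have hTabs : ∀ b, |T b x| ≤ T |b| |x| := fun b => by
    refine abs_le'.2 ⟨(hP.le_iff _ _).2 fun g hg => ?_, (hP.le_iff _ _).2 fun g hg => ?_⟩
    · rw [hT, hT]
      exact (le_abs_self _).trans (hΘ.abs_pairing_le hP x hg b)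
    · rw [map_neg, LinearMap.neg_apply, hT, hT]
      exact (neg_le_abs _).trans (hΘ.abs_pairing_le hP x hg b)
  have hβ : ∀ a b, |β a b| ≤ c * hΘ.orbitFunctional hP |x| f (|a| * |b|) := fun a b => by
    have hf' : 0 ≤ Θ |a| f := hΘ.nonneg (abs_nonneg a) hf
    have h1 := hP.apply_mono (hS (T b x)) hf'
    rw [map_smul, LinearMap.smul_apply, smul_eq_mul] at h1
    have h2 := mul_le_mul_of_nonneg_left (hP.apply_mono (hTabs b) hf') hc
    rw [hT, algHom_apply_comm, ← Module.End.mul_apply, ← map_mul] at h2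
    exact (hΘ.abs_pairing_le hP _ hf a).trans (h1.trans h2)
  have key := apply_one_eq_apply_one_of_abs_le β
    (fun a ha => hP.apply_nonneg (abs_nonneg x) (hΘ.nonneg ha hf)) hc hβ h
  have hT1 : T 1 x = x := hP.inj _ _ fun g => by simp [hT]
  simpa [β, hT1, hT] using key

/-- Every central operator on `W` is induced by an element of the bidual of `C(K)`. -/
theorem exists_bidual_eq [T2Space K] [PosSMulMono ℝ V] (hΘ : IsCyclicAction Θ)
    (hP : IsOrderDual V W fun x f => P x f) {S : W →ₗ[ℝ] W} {c : ℝ} (hc : 0 ≤ c)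
    (hS : ∀ x, |S x| ≤ c • |x|) : ∃ F : (C(K, ℝ) →L[ℝ] ℝ) →L[ℝ] ℝ,
      ∀ x f, 0 ≤ f → F (hΘ.orbitFunctional hP x f) = P (S x) f := by
  obtain ⟨T, hT⟩ := hΘ.exists_transpose hP
  have hST := fun h x => hΘ.map_transpose hP hc hS hT h x
  let G : Submodule ℝ ((C(K, ℝ) →L[ℝ] ℝ) × ℝ) :=
    { carrier := {q | ∃ f, 0 ≤ f ∧ ∃ y, q = (hΘ.orbitFunctional hP y f, P (S y) f)}
      zero_mem' := ⟨0, le_rfl, 0, by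
        ext <;> simp [orbitFunctional_apply]⟩
      add_mem' := by
        rintro _ _ ⟨f, hf, y, rfl⟩ ⟨g, hg, z, rfl⟩
        obtain ⟨h, -, hh⟩ := hΘ.exists_eq (g := f) (add_nonneg hf hg)
          (by rw [abs_of_nonneg hf]; exact le_add_of_nonneg_right hg)
        obtain ⟨k, -, hk⟩ := hΘ.exists_eq (g := g) (add_nonneg hf hg)
          (by rw [abs_of_nonneg hg]; exact le_add_of_nonneg_left hf)
        refine ⟨f + g, add_nonneg hf hg, T h y + T k z, Prod.ext ?_ ?_⟩
        · ext a
          change P y (Θ a f) + P z (Θ a g) = P (T h y + T k z) (Θ a (f + g))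
          rw [map_add P, LinearMap.add_apply, hT, hT, algHom_apply_comm Θ h, algHom_apply_comm Θ k, hh, hk]
        · change P (S y) f + P (S z) g = P (S (T h y + T k z)) (f + g)
          rw [map_add S, map_add P, LinearMap.add_apply, hST, hST, hT, hT, hh, hk]
      smul_mem' := by
        rintro t _ ⟨f, hf, y, rfl⟩
        exact ⟨f, hf, t • y, by ext <;> simp [orbitFunctional_apply]⟩ }
  have hG : ∀ q ∈ G, |q.2| ≤ c * ‖q.1‖ := by
    rintro _ ⟨f, hf, y, rfl⟩
    have h1 := hP.apply_mono (hS y) hf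
    rw [map_smul, LinearMap.smul_apply, smul_eq_mul] at h1
    have h2 := hP.abs_apply_le (S y) f
    rw [abs_of_nonneg hf] at h2
    exact h2.trans (h1.trans (mul_le_mul_of_nonneg_left
      (hΘ.pairing_abs_le_norm_orbitFunctional hP y hf) hc))
  obtain ⟨F, hF⟩ := exists_clm_of_submodule_prod (V := StrongDual ℝ C(K, ℝ)) hc hG
  exact ⟨F, fun x f hf => hF _ ⟨f, hf, x, rfl⟩⟩

theorem orbitFunctional_add_left (hΘ : IsCyclicAction Θ)
    (hP : IsOrderDual V W fun x f => P x f) (x y : W) (f : V) :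
    hΘ.orbitFunctional hP (x + y) f = hΘ.orbitFunctional hP x f + hΘ.orbitFunctional hP y f := by
  ext h
  simp [orbitFunctional_apply]

theorem orbitFunctional_smul_left (hΘ : IsCyclicAction Θ)
    (hP : IsOrderDual V W fun x f => P x f) (t : ℝ) (x : W) (f : V) :
    hΘ.orbitFunctional hP (t • x) f = t • hΘ.orbitFunctional hP x f := by
  ext h
  simp [orbitFunctional_apply]

/-- Operators on `W` induced by elements of the bidual of `C(K)` are central. -/
theorem isCentral_of_bidual [PosSMulMono ℝ W] (hΘ : IsCyclicAction Θ)
    (hP : IsOrderDual V W fun x f => P x f) {F : (C(K, ℝ) →L[ℝ] ℝ) →L[ℝ] ℝ} {S : W → W}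
    (hS : ∀ x f, P (S x) f = F (hΘ.orbitFunctional hP x f)) : IsCentral S := by
  obtain ⟨B, hB0, hB⟩ := exists_abs_bidual_le F
  let S' : W →ₗ[ℝ] W :=
    { toFun := S
      map_add' := fun x y => hP.inj _ _ fun f => by
        simp [hS, orbitFunctional_add_left]
      map_smul' := fun t x => hP.inj _ _ fun f => by
        simp [hS, orbitFunctional_smul_left] }
  have key : ∀ x f, 0 ≤ f → |P (S x) f| ≤ P (B • |x|) f := fun x f hf => by
    have h := hΘ.norm_orbitFunctional_le hP x f
    rw [abs_of_nonneg hf] at h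
    rw [hS, map_smul, LinearMap.smul_apply, smul_eq_mul]
    exact (hB _).trans (mul_le_mul_of_nonneg_left h hB0)
  refine isCentral_of_abs_le S' (c := B) fun x => ?_
  refine abs_le'.2 ⟨(hP.le_iff _ _).2 fun f hf => (le_abs_self _).trans (key x f hf),
    (hP.le_iff _ _).2 fun f hf => ?_⟩
  rw [map_neg]
  exact (neg_le_abs _).trans (key x f hf)

end IsCyclicAction

end CenterAction

section IdealCenter

/-- In a Dedekind complete Riesz space, every element of `[-f, f]` is the image of `f` under an
operator dominated by the identity. -/
theorem exists_linearMap_abs_le {V : Type*} [Lattice V] [AddCommGroup V] [IsOrderedAddMonoid V]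
    [Module ℝ V] [PosSMulMono ℝ V]
    (hV : ∀ s : Set V, s.Nonempty → BddAbove s → ∃ d, IsLUB s d) {f g : V} (hfg : |g| ≤ f) :
    ∃ T : V →ₗ[ℝ] V, T f = g ∧ ∀ u, |T u| ≤ |u| := by
  have hf0 : 0 ≤ f := (abs_nonneg g).trans hfg
  have habs : ∀ t : ℝ, |t • g| ≤ |t • f| := fun t => by
    rw [abs_smul_eq_abs_smul_abs, abs_smul_eq_abs_smul_abs, abs_of_nonneg hf0]
    exact smul_le_smul_of_nonneg_left hfg (abs_nonneg t)
  have hzero : ∀ t : ℝ, t • f = 0 → t • g = 0 := fun t ht => by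
    have h := abs_le'.1 (habs t)
    rw [ht, abs_of_nonneg le_rfl, neg_nonpos] at h
    exact le_antisymm h.1 h.2
  obtain ⟨T, hT, hTle⟩ := exists_extension_of_le_sublinear_of_isLUB hV (fun u : V => |u|)
    (fun c x hc => abs_smul_of_pos hc x) abs_add_le
    (LinearPMap.mkSpanSingleton' f g (σ := RingHom.id ℝ) hzero) (by
      rintro ⟨x, hx⟩
      obtain ⟨t, rfl⟩ := Submodule.mem_span_singleton.1 hx
      rw [LinearPMap.mkSpanSingleton'_apply]
      exact (le_abs_self _).trans (habs t))
  refine ⟨T, ?_, fun u => abs_le'.2 ⟨hTle u, by simpa using hTle (-u)⟩⟩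
  have h := (hT ⟨(1 : ℝ) • f, Submodule.mem_span_singleton.2 ⟨1, rfl⟩⟩).trans
    (LinearPMap.mkSpanSingleton'_apply f g hzero 1 _)
  simpa using h

/-- The ideal center of the order dual of a Riesz space acts cyclically. -/
theorem IsOrderDual.isCyclicAction {K X Y : Type*} [TopologicalSpace K] [CompactSpace K]
    [Lattice X] [AddCommGroup X] [IsOrderedAddMonoid X] [Module ℝ X] [PosSMulMono ℝ X]
    [Lattice Y] [AddCommGroup Y] [IsOrderedAddMonoid Y] [Module ℝ Y] [PosSMulMono ℝ Y]
    {P : Y →ₗ[ℝ] X →ₗ[ℝ] ℝ} (hP : IsOrderDual X Y fun y x => P y x)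
    {Θ : C(K, ℝ) →ₐ[ℝ] Module.End ℝ Y}
    (hsurj : ∀ T : Y →ₗ[ℝ] Y, IsCentral (fun y => T y) → ∃ h, Θ h = T)
    (hlat : ∀ (h k : C(K, ℝ)) (f : Y), 0 ≤ f → Θ (h ⊔ k) f = Θ h f ⊔ Θ k f)
    (hnorm : ∀ h : C(K, ℝ), ‖h‖ =
      sInf {c : ℝ | 0 ≤ c ∧ ∀ f : Y, 0 ≤ f → -(c • f) ≤ Θ h f ∧ Θ h f ≤ c • f}) :
    IsCyclicAction Θ where
  nonneg {h f} hh hf := by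
    have := hlat h 0 f hf
    rw [sup_of_le_left hh, map_zero, LinearMap.zero_apply] at this
    exact this ▸ le_sup_right
  exists_eq {f g} hf hg := by
    obtain ⟨T, rfl, hT⟩ := exists_linearMap_abs_le hP.exists_isLUB hg
    obtain ⟨h, rfl⟩ := hsurj T (isCentral_of_abs_le T (c := 1) fun u => by simpa using hT u)
    refine ⟨h, ?_, rfl⟩
    rw [hnorm]
    refine csInf_le ⟨0, fun c hc => hc.1⟩ ⟨zero_le_one, fun u hu => ?_⟩
    have := hT u
    rw [abs_of_nonneg hu] at this
    rw [one_smul]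
    exact abs_le_iff_neg_le_and_le.1 this

end IdealCenter
/-- Corollary 6(2).  Let `E` be a Riesz space with point separating
order dual (realized as `D`, order bidual realized as `DD`), write `Z(E^∼) = C(K)` with
`K` hyperstonian (realized by an algebra/lattice isomorphism `Θ` of `C(K)` onto
`Z(E^∼)`), and let `m : Z(E^∼)'' = C(K)'' → Z(E^{∼∼})` be the Arens homomorphism of the
bidual of `Z(E^∼)`.  Then there is an idempotent `π ∈ C(K)''` (for the Arens product)
such that `Z(E^{∼∼}) = π⬝C(K)''` and `Ker(m) = (1-π)⬝C(K)''`. -/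
theorem statement16
    {E D DD K : Type*}
    [Lattice E] [AddCommGroup E] [Module ℝ E]
    [CovariantClass E E (· + ·) (· ≤ ·)] [PosSMulMono ℝ E]
    [Lattice D] [AddCommGroup D] [Module ℝ D]
    [CovariantClass D D (· + ·) (· ≤ ·)] [PosSMulMono ℝ D]
    [Lattice DD] [AddCommGroup DD] [Module ℝ DD]
    [CovariantClass DD DD (· + ·) (· ≤ ·)] [PosSMulMono ℝ DD]
    [TopologicalSpace K] [CompactSpace K] [T2Space K]
    (pE : D → E → ℝ) (hD : IsOrderDual E D pE) (hsep : SepPoints pE)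
    -- `DD` realizes the order bidual `E^{∼∼} = (E^∼)^∼`:
    (pD : DD → D → ℝ) (hDD : IsOrderDual D DD pD)
    -- `K` is hyperstonian:
    (hStonian : ExtremallyDisconnected K)
    (hKsep : ∀ h : C(K, ℝ), h ≠ 0 → ∃ φ : C(K, ℝ) → ℝ,
      IsLinearMap ℝ φ ∧ IsOrdBdd φ ∧ IsOrderContinuousFun φ ∧ φ h ≠ 0)
    -- `Θ` realizes `Z(E^∼) = C(K)`:
    (Θ : C(K, ℝ) → D → D)
    (hΘadd : ∀ h h' : C(K, ℝ), Θ (h + h') = Θ h + Θ h')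
    (hΘsmul : ∀ (c : ℝ) (h : C(K, ℝ)), Θ (c • h) = c • Θ h)
    (hΘmul : ∀ (h h' : C(K, ℝ)) (f : D), Θ (h * h') f = Θ h (Θ h' f))
    (hΘone : ∀ f : D, Θ 1 f = f)
    (hΘinj : Function.Injective Θ)
    (hΘcentral : ∀ h : C(K, ℝ), IsCentral (Θ h))
    (hΘsurj : ∀ S : D → D, IsCentral S → ∃ h : C(K, ℝ), Θ h = S)
    (hΘlat : ∀ (h h' : C(K, ℝ)) (f : D), 0 ≤ f → Θ (h ⊔ h') f = Θ h f ⊔ Θ h' f)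
    (hΘnorm : ∀ h : C(K, ℝ), ‖h‖ =
      sInf {c : ℝ | 0 ≤ c ∧ ∀ f : D, 0 ≤ f → -(c • f) ≤ Θ h f ∧ Θ h f ≤ c • f})
    -- the Arens homomorphism `m : C(K)'' → Z(E^{∼∼})`, `m(F)(x'')(f) = F(μ_{f,x''})`
    -- where `μ_{f,x''}(T) = x''(Tf)`:
    (m : ((C(K, ℝ) →L[ℝ] ℝ) →L[ℝ] ℝ) → DD → DD)
    (hm : ∀ (F : (C(K, ℝ) →L[ℝ] ℝ) →L[ℝ] ℝ) (x'' : DD) (f : D) (μ : C(K, ℝ) →L[ℝ] ℝ),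
      (∀ h : C(K, ℝ), μ h = pD x'' (Θ h f)) → pD (m F x'') f = F μ) :
    ∃ π : (C(K, ℝ) →L[ℝ] ℝ) →L[ℝ] ℝ,
      -- `π` is an Arens idempotent:
      arensMul C(K, ℝ) π π = π ∧
      -- `Z(E^{∼∼}) = π⬝C(K)''`:
      {S : DD → DD | IsCentral S} = Set.range (fun F => m (arensMul C(K, ℝ) π F)) ∧
      -- `Ker(m) = (1-π)⬝C(K)''`:
      {F : (C(K, ℝ) →L[ℝ] ℝ) →L[ℝ] ℝ | ∀ x'' : DD, m F x'' = 0} =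
        Set.range (fun F => arensMul C(K, ℝ) (arensOne C(K, ℝ) - π) F) := by
  have : IsOrderedAddMonoid E := { add_le_add_left := fun a b h c => add_le_add_left h c }
  have : IsOrderedAddMonoid D := { add_le_add_left := fun a b h c => add_le_add_left h c }
  have : IsOrderedAddMonoid DD := { add_le_add_left := fun a b h c => add_le_add_left h c }
  let PE : D →ₗ[ℝ] E →ₗ[ℝ] ℝ := LinearMap.mk₂ ℝ pE
    (fun f g x => (hD.lin_vec x).map_add f g) (fun c f x => (hD.lin_vec x).map_smul c f)
    (fun f x y => (hD.lin_fun f).map_add x y) (fun c f x => (hD.lin_fun f).map_smul c x)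
  let PD : DD →ₗ[ℝ] D →ₗ[ℝ] ℝ := LinearMap.mk₂ ℝ pD
    (fun f g x => (hDD.lin_vec x).map_add f g) (fun c f x => (hDD.lin_vec x).map_smul c f)
    (fun f x y => (hDD.lin_fun f).map_add x y) (fun c f x => (hDD.lin_fun f).map_smul c x)
  have hPE : IsOrderDual E D fun f x => PE f x := hD
  have hPD : IsOrderDual D DD fun x f => PD x f := hDD
  let Θ' : C(K, ℝ) →ₐ[ℝ] Module.End ℝ D := AlgHom.ofLinearMap
    { toFun := fun h => (hΘcentral h).1.1.mk' _
      map_add' := fun h k => LinearMap.ext fun f => congrFun (hΘadd h k) f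
      map_smul' := fun c h => LinearMap.ext fun f => congrFun (hΘsmul c h) f }
    (LinearMap.ext hΘone) (fun h k => LinearMap.ext (hΘmul h k))
  have hΘ : IsCyclicAction Θ' := hPE.isCyclicAction
    (fun T hT => (hΘsurj _ hT).imp fun h hh => LinearMap.ext (congrFun hh)) hΘlat hΘnorm
  have hmF : ∀ F x f, PD (m F x) f = F (hΘ.orbitFunctional hPD x f) := fun F x f =>
    hm F x f _ fun h => rfl
  let M : Set (C(K, ℝ) →L[ℝ] ℝ) := {μ | ∃ x f, hΘ.orbitFunctional hPD x f = μ}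
  have hM : ∀ F G : (C(K, ℝ) →L[ℝ] ℝ) →L[ℝ] ℝ,
      (∀ μ ∈ M, G μ = 0) → ∀ μ ∈ M, arensMul C(K, ℝ) F G μ = 0 := by
    rintro F G hG _ ⟨x, f, rfl⟩
    exact hΘ.arensMul_orbitFunctional_eq_zero hPD F (fun y g => hG _ ⟨y, g, rfl⟩) x f
  have hker : ∀ F, (∀ x, m F x = 0) ↔ ∀ μ ∈ M, F μ = 0 := by
    refine fun F => ⟨?_, fun h x => hPD.inj _ _ fun f => ?_⟩
    · rintro h _ ⟨x, f, rfl⟩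
      rw [← hmF, h, map_zero, LinearMap.zero_apply]
    · rw [hmF, h _ ⟨x, f, rfl⟩, map_zero, LinearMap.zero_apply]
  obtain ⟨e, heM, hee, he⟩ := exists_idempotent_of_annihilator M hM
  have hmul : ∀ F, arensMul C(K, ℝ) (arensOne C(K, ℝ) - e) F = F - arensMul C(K, ℝ) e F :=
    fun F => congrArg (· - arensMul C(K, ℝ) e F) (arensOne_arensMul F)
  have hm_mul : ∀ F, m (arensMul C(K, ℝ) (arensOne C(K, ℝ) - e) F) = m F := fun F =>
    funext fun x => hPD.inj _ _ fun f => by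
      rw [hmF, hmF, hmul, sub_apply, arensMul_comm, hM F e heM _ ⟨x, f, rfl⟩, sub_zero]
  have hsub : arensOne C(K, ℝ) - (arensOne C(K, ℝ) - e) = e :=
    ContinuousLinearMap.ext fun μ => sub_sub_cancel (arensOne C(K, ℝ) μ) (e μ)
  refine ⟨arensOne C(K, ℝ) - e, ?_, Set.ext fun S => ⟨fun hS => ?_, ?_⟩,
    Set.ext fun F => ⟨fun hF => ⟨F, ?_⟩, ?_⟩⟩
  · rw [hmul, arensMul_comm, hmul, hee]
    exact ContinuousLinearMap.ext fun μ => by simp only [sub_apply, sub_self, sub_zero]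
  · obtain ⟨c, hc, hSc⟩ := hS.exists_abs_le
    obtain ⟨F, hF⟩ := hΘ.exists_bidual_eq hPD (S := hS.1.1.mk' S) hc hSc
    refine ⟨F, (hm_mul F).trans (funext fun x => hPD.ext_of_nonneg fun f hf => ?_)⟩
    exact (hmF F x f).trans (hF x f hf)
  · rintro ⟨F, rfl⟩
    exact hΘ.isCentral_of_bidual hPD (hmF _)
  · change arensMul C(K, ℝ) (arensOne C(K, ℝ) - (arensOne C(K, ℝ) - e)) F = F
    rw [hsub]
    exact he F ((hker F).1 hF)
  · rintro ⟨F, rfl⟩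
    refine (hker _).2 ?_
    change ∀ μ ∈ M, arensMul C(K, ℝ) (arensOne C(K, ℝ) - (arensOne C(K, ℝ) - e)) F μ = 0
    rw [hsub, arensMul_comm]
    exact hM F e heM
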